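/- arXiv:2109.10887 — 2 statements merged into one kernel-verified Lean document; each statement's English description precedes it below -/
import Mathlib

section
/- For every x ∈ ℝ, lim_{N→∞} √N · Σ_{n=N+1}^∞ H_n(x)² / (2n · 2ⁿ · n! · √π) = exp(x²)/(√2 · π). Moreover, for all x, y ∈ ℝ with x ≠ y and every real γ < 1, lim_{N→∞} N^γ · Σ_{n=N+1}^∞ H_n(x)H_n(y) / (2n · 2ⁿ · n! · √π) = 0. -/
open Filter Topology

/-- The physicist Hermite polynomials, defined by their three-term recurrence. -/
noncomputable def physHermite : ℕ → ℝ → ℝ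
  | 0 => fun _ => 1
  | 1 => fun x => 2 * x
  | (n + 2) => fun x => 2 * x * physHermite (n + 1) x - 2 * (n + 1) * physHermite n x

theorem pH_zero (x : ℝ) : physHermite 0 x = 1 := by simp [physHermite]
theorem pH_one (x : ℝ) : physHermite 1 x = 2 * x := by simp [physHermite]
theorem pH_rec (n : ℕ) (x : ℝ) : physHermite (n + 2) x =
    2 * x * physHermite (n + 1) x - 2 * (n + 1) * physHermite n x := by
  simp [physHermite]

noncomputable def Wn (n : ℕ) : ℝ := 2 ^ n * (n.factorial : ℝ)

theorem Wn_pos (n : ℕ) : 0 < Wn n := by unfold Wn; positivity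

theorem Wn_succ (n : ℕ) : Wn (n + 1) = 2 * (n + 1) * Wn n := by
  unfold Wn; rw [Nat.factorial_succ]; push_cast; ring

/-- the derivative, including the index zero -/
noncomputable def dH : ℕ → ℝ → ℝ
  | 0 => fun _ => 0
  | (n + 1) => fun x => 2 * (n + 1) * physHermite n x

theorem pH_succ (n : ℕ) (x : ℝ) :
    physHermite (n + 1) x = 2 * x * physHermite n x - dH n x := by
  cases n with
  | zero => simp [pH_zero, pH_one, dH]
  | succ n => rw [pH_rec]; simp [dH]

theorem pH_deriv_aux (n : ℕ) (x : ℝ) :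
    HasDerivAt (physHermite n) (dH n x) x ∧
      HasDerivAt (physHermite (n + 1)) (dH (n + 1) x) x := by
  induction n with
  | zero =>
    constructor
    · have : physHermite 0 = fun _ => (1 : ℝ) := by ext; simp [pH_zero]
      rw [this]; simpa [dH] using hasDerivAt_const x (1 : ℝ)
    · have : physHermite 1 = fun x : ℝ => 2 * x := by ext; simp [pH_one]
      rw [zero_add, this]; simpa [dH, pH_zero] using (hasDerivAt_id x).const_mul (2 : ℝ)
  | succ n ih =>
    refine ⟨ih.2, ?_⟩
    have h1 : physHermite (n + 1 + 1) = fun x =>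
      2 * x * physHermite (n + 1) x - 2 * (n + 1) * physHermite n x := by
      ext y; exact pH_rec n y
    rw [h1]
    have := (((hasDerivAt_id x).const_mul (2 : ℝ)).mul ih.2).sub
      (ih.1.const_mul (2 * ((n : ℝ) + 1)))
    refine this.congr_deriv ?_
    have h2 := pH_succ n x
    have h3 : dH (n + 1) x = 2 * (n + 1) * physHermite n x := rfl
    have h4 : dH (n + 1 + 1) x = 2 * (((n + 1 : ℕ) : ℝ) + 1) * physHermite (n + 1) x := rfl
    rw [h3, h4, h2]; push_cast; simp only [id]; ring

theorem pH_deriv (n : ℕ) (x : ℝ) : HasDerivAt (physHermite n) (dH n x) x :=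
  (pH_deriv_aux n x).1

theorem dH_deriv (n : ℕ) (x : ℝ) :
    HasDerivAt (dH n) (2 * x * dH n x - 2 * n * physHermite n x) x := by
  cases n with
  | zero => simpa [dH] using hasDerivAt_const x (0 : ℝ)
  | succ n =>
    have := (pH_deriv n x).const_mul (2 * ((n : ℝ) + 1))
    refine this.congr_deriv ?_
    rw [pH_succ n x]; simp only [dH]; push_cast; ring

noncomputable def En (n : ℕ) (x : ℝ) : ℝ :=
  Real.exp (-x ^ 2) * (dH n x ^ 2 - 2 * x * (physHermite n x * dH n x)
    + (2 * n + 1) * physHermite n x ^ 2)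

theorem exp_deriv (x : ℝ) :
    HasDerivAt (fun x : ℝ => Real.exp (-x ^ 2)) (Real.exp (-x ^ 2) * (-(2 * x))) x := by
  have := ((hasDerivAt_pow 2 x).neg).exp
  simpa using this

theorem En_deriv (n : ℕ) (x : ℝ) :
    HasDerivAt (En n) (-(2 * x) * (Real.exp (-x ^ 2) * physHermite n x ^ 2)) x := by
  have h1 := pH_deriv n x
  have h2 := dH_deriv n x
  have h3 := (exp_deriv x).mul ((((h2.pow 2).sub (((hasDerivAt_id x).const_mul (2 : ℝ)).mul
    (h1.mul h2))).add ((h1.pow 2).const_mul (2 * (n : ℝ) + 1))))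
  refine h3.congr_deriv ?_
  simp
  ring

theorem En_le (n : ℕ) (x : ℝ) : En n x ≤ En n 0 := by
  have hd : Differentiable ℝ (En n) := fun x => (En_deriv n x).differentiableAt
  rcases le_total 0 x with hx | hx
  · have : AntitoneOn (En n) (Set.Ici 0) := by
      apply antitoneOn_of_deriv_nonpos (convex_Ici 0) hd.continuous.continuousOn
        hd.differentiableOn
      intro y hy
      rw [interior_Ici] at hy
      rw [(En_deriv n y).deriv]
      have : 0 < y := hy
      have : 0 ≤ (2 * y) * (Real.exp (-y ^ 2) * physHermite n y ^ 2) := by positivity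
      linarith
    exact this Set.self_mem_Ici hx hx
  · have : MonotoneOn (En n) (Set.Iic 0) := by
      apply monotoneOn_of_deriv_nonneg (convex_Iic 0) hd.continuous.continuousOn
        hd.differentiableOn
      intro y hy
      rw [interior_Iic] at hy
      rw [(En_deriv n y).deriv]
      have : y < 0 := hy
      have h1 : 0 ≤ -(2 * y) := by linarith
      positivity
    exact this hx Set.self_mem_Iic hx

/-- central binomial over 4^m, as a product -/
noncomputable def cb : ℕ → ℝ
  | 0 => 1
  | (m + 1) => cb m * ((2 * m + 1) / (2 * m + 2))

theorem cb_pos (m : ℕ) : 0 < cb m := by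
  induction m with
  | zero => simp [cb]
  | succ m ih => simp only [cb]; positivity

theorem cb_wallis (m : ℕ) : cb m ^ 2 * (2 * m + 1) * Real.Wallis.W m = 1 := by
  induction m with
  | zero => simp [cb, Real.Wallis.W]
  | succ m ih =>
    rw [Real.Wallis.W_succ]
    refine Eq.trans ?_ ih
    simp only [cb]; push_cast
    have : (2 * (m : ℝ) + 1) ≠ 0 := by positivity
    have : (2 * (m : ℝ) + 2) ≠ 0 := by positivity
    have : (2 * (m : ℝ) + 3) ≠ 0 := by positivity
    field_simp
    ring

theorem cb_le (m : ℕ) : cb m ^ 2 * (2 * m + 1) ≤ 1 := by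
  induction m with
  | zero => simp [cb]
  | succ m ih =>
    refine le_trans ?_ ih
    simp only [cb]; push_cast
    have e : (cb m * ((2 * (m : ℝ) + 1) / (2 * m + 2))) ^ 2 * (2 * (m + 1) + 1)
      = cb m ^ 2 * (2 * m + 1) * (((2 * m + 1) * (2 * m + 3)) / (2 * m + 2) ^ 2) := by
      field_simp; ring
    rw [e]
    apply mul_le_of_le_one_right (by positivity)
    rw [div_le_one (by positivity)]
    nlinarith

theorem pH_even_zero (m : ℕ) :
    physHermite (2 * m) 0 ^ 2 = cb m * Wn (2 * m) ∧ physHermite (2 * m + 1) 0 = 0 := by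
  induction m with
  | zero => simp [pH_zero, pH_one, cb, Wn]
  | succ m ih =>
    have e : 2 * (m + 1) = 2 * m + 2 := by ring
    rw [e]
    constructor
    · rw [pH_rec, Wn_succ, Wn_succ, ih.2]
      have : (2 * (((2 * m : ℕ) : ℝ)) + 2) ≠ 0 := by positivity
      have e2 : (2 * 0 * 0 - 2 * (((2 * m : ℕ) : ℝ) + 1) * physHermite (2 * m) 0) ^ 2
        = 4 * (((2 * m : ℕ) : ℝ) + 1) ^ 2 * physHermite (2 * m) 0 ^ 2 := by ring
      rw [e2, ih.1]
      simp only [cb]; push_cast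
      field_simp
      ring
    · rw [show 2 * m + 2 + 1 = 2 * m + 1 + 2 by ring, pH_rec, ih.2]; ring

theorem cb_half_le (n : ℕ) : cb (n / 2) * Real.sqrt n ≤ 1 := by
  have h := cb_le (n / 2)
  have h0 := (cb_pos (n / 2)).le
  have h1 : (n : ℝ) ≤ 2 * ((n / 2 : ℕ) : ℝ) + 1 := by
    have : n ≤ 2 * (n / 2) + 1 := by omega
    exact_mod_cast this
  have h2 : (cb (n / 2) * Real.sqrt n) ^ 2 ≤ 1 := by
    rw [mul_pow, Real.sq_sqrt (by positivity)]
    refine le_trans ?_ h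
    gcongr
  exact (sq_le_one_iff₀ (by positivity)).1 h2

theorem En_zero_le (n : ℕ) : En n 0 ≤ (2 * n + 1) * cb (n / 2) * Wn n := by
  have hE : En n 0 = dH n 0 ^ 2 + (2 * n + 1) * physHermite n 0 ^ 2 := by
    simp [En]
  rw [hE]
  rcases Nat.even_or_odd' n with ⟨m, rfl | rfl⟩
  · have h1 : dH (2 * m) 0 = 0 := by
      cases m with
      | zero => simp [dH]
      | succ m =>
        rw [show 2 * (m + 1) = 2 * m + 1 + 1 by ring]
        simp [dH, (pH_even_zero m).2]
    rw [h1, (pH_even_zero m).1, show 2 * m / 2 = m by omega]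
    apply le_of_eq; ring
  · rw [(pH_even_zero m).2, show (2 * m + 1) / 2 = m by omega, Wn_succ]
    have h2 : dH (2 * m + 1) 0 ^ 2 = 4 * (2 * m + 1) ^ 2 * (cb m * Wn (2 * m)) := by
      rw [← (pH_even_zero m).1]; simp [dH]; ring
    rw [h2]
    have := cb_pos m
    have := Wn_pos (2 * m)
    push_cast
    have h3 : 0 < cb m * Wn (2 * m) * (2 * m + 1) := by positivity
    nlinarith

theorem pH_bound (n : ℕ) (hn : 1 ≤ n) (x : ℝ) (hx : x ^ 2 ≤ n) :
    Real.exp (-x ^ 2) * physHermite n x ^ 2 * Real.sqrt n ≤ 2 * Wn n := by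
  have h1 := (En_le n x).trans (En_zero_le n)
  have h2 : (2 * n + 1 - x ^ 2) * (Real.exp (-x ^ 2) * physHermite n x ^ 2) ≤ En n x := by
    have : 0 ≤ Real.exp (-x ^ 2) * (dH n x - x * physHermite n x) ^ 2 := by positivity
    unfold En
    nlinarith
  have h3 := cb_half_le n
  set q := Real.exp (-x ^ 2) * physHermite n x ^ 2 with hq
  have hq0 : 0 ≤ q := by positivity
  have h4 : ((2 * n + 1 : ℝ) / 2) * q ≤ (2 * n + 1) * cb (n / 2) * Wn n := by
    refine le_trans ?_ (h2.trans h1)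
    gcongr
    linarith
  have h5 : q ≤ 2 * cb (n / 2) * Wn n := by
    have : (0 : ℝ) < (2 * n + 1) := by positivity
    by_contra! hc
    have := mul_lt_mul_of_pos_left hc this
    linarith
  calc q * Real.sqrt n ≤ 2 * cb (n / 2) * Wn n * Real.sqrt n := by gcongr
    _ = 2 * Wn n * (cb (n / 2) * Real.sqrt n) := by ring
    _ ≤ 2 * Wn n * 1 := by
      have := Wn_pos n
      gcongr
    _ = _ := by ring

/-- Christoffel–Darboux kernel (without the constant `√π`). -/
noncomputable def Ker (x y : ℝ) (n : ℕ) : ℝ :=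
  ∑ i ∈ Finset.range (n + 1), physHermite i x * physHermite i y / Wn i

theorem Ker_succ (x y : ℝ) (n : ℕ) :
    Ker x y (n + 1) = Ker x y n + physHermite (n + 1) x * physHermite (n + 1) y / Wn (n + 1) := by
  unfold Ker; rw [Finset.sum_range_succ]

theorem Ker_zero (x y : ℝ) : Ker x y 0 = 1 := by
  simp [Ker, pH_zero, Wn]

theorem Ker_CD (x y : ℝ) (n : ℕ) :
    (x - y) * Ker x y n * (2 * Wn n) =
      physHermite (n + 1) x * physHermite n y - physHermite n x * physHermite (n + 1) y := by
  induction n with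
  | zero => simp [Ker_zero, pH_zero, pH_one, Wn]; ring
  | succ n ih =>
    rw [Ker_succ, pH_rec, pH_rec, Wn_succ]
    have := (Wn_pos n).ne'
    have h2 : ((n : ℝ) + 1) ≠ 0 := by positivity
    have e : (x - y) * (Ker x y n + physHermite (n + 1) x * physHermite (n + 1) y /
        (2 * (n + 1) * Wn n)) * (2 * (2 * (n + 1) * Wn n))
      = 2 * (n + 1) * ((x - y) * Ker x y n * (2 * Wn n)) +
        2 * (x - y) * (physHermite (n + 1) x * physHermite (n + 1) y) := by
      field_simp
    rw [e, ih]; ring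

theorem Ker_diag_deriv (n : ℕ) (x : ℝ) :
    HasDerivAt (fun t => Real.exp (-t ^ 2) * Ker t t n)
      (-(Real.exp (-x ^ 2) * (physHermite n x * physHermite (n + 1) x) / Wn n)) x := by
  induction n with
  | zero =>
    simp only [Ker_zero, pH_zero, zero_add, pH_one]
    refine ((exp_deriv x).mul_const 1).congr_deriv ?_
    simp [Wn]
  | succ n ih =>
    have h1 := pH_deriv (n + 1) x
    have h := ih.add ((exp_deriv x).mul ((h1.mul h1).div_const (Wn (n + 1))))
    have e : (fun t => Real.exp (-t ^ 2) * Ker t t (n + 1)) = (fun t => Real.exp (-t ^ 2) * Ker t t n)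
      + (fun t => Real.exp (-t ^ 2)) * (fun t => (physHermite (n + 1) * physHermite (n + 1)) t / Wn (n + 1)) := by
      ext t; simp [Ker_succ]; ring
    rw [e]
    refine h.congr_deriv ?_
    have h3 : dH (n + 1) x = 2 * (n + 1) * physHermite n x := rfl
    rw [h3, pH_rec, Wn_succ]
    have := (Wn_pos n).ne'
    have h2 : ((n : ℝ) + 1) ≠ 0 := by positivity
    simp
    field_simp
    ring

theorem prod_bound (n : ℕ) (hn : 1 ≤ n) (x y : ℝ) (hx : x ^ 2 ≤ n) (hy : y ^ 2 ≤ n) :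
    |physHermite n x * physHermite (n + 1) y| ≤
      4 * Real.exp (x ^ 2 / 2) * Real.exp (y ^ 2 / 2) * Wn n := by
  have h1 := pH_bound n hn x hx
  have h2 := pH_bound (n + 1) (by omega) y (by push_cast; linarith)
  rw [Wn_succ] at h2
  have hW := Wn_pos n
  have hn' : (1 : ℝ) ≤ n := by exact_mod_cast hn
  set s := Real.sqrt n with hs
  set t := Real.sqrt ((n + 1 : ℕ) : ℝ) with ht
  have hs2 : s ^ 2 = n := Real.sq_sqrt (by positivity)
  have ht2 : t ^ 2 = n + 1 := by rw [ht, Real.sq_sqrt (by positivity)]; push_cast; ring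
  have hs0 : 0 < s := Real.sqrt_pos.2 (by linarith)
  have ht0 : 0 < t := Real.sqrt_pos.2 (by positivity)
  have hts : t ≤ 2 * s := by
    apply le_of_sq_le_sq _ (by positivity)
    nlinarith
  have ex : Real.exp (-x ^ 2) = (Real.exp (x ^ 2 / 2) ^ 2)⁻¹ := by
    rw [← Real.exp_nat_mul, ← Real.exp_neg]; congr 1; push_cast; ring
  have ey : Real.exp (-y ^ 2) = (Real.exp (y ^ 2 / 2) ^ 2)⁻¹ := by
    rw [← Real.exp_nat_mul, ← Real.exp_neg]; congr 1; push_cast; ring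
  rw [ex] at h1
  rw [ey] at h2
  set a := Real.exp (x ^ 2 / 2)
  set b := Real.exp (y ^ 2 / 2)
  have ha : 0 < a := Real.exp_pos _
  have hb : 0 < b := Real.exp_pos _
  have h1' : physHermite n x ^ 2 * s ≤ 2 * Wn n * a ^ 2 := by
    have := mul_le_mul_of_nonneg_right h1 (sq_nonneg a)
    calc _ = (a ^ 2)⁻¹ * physHermite n x ^ 2 * s * a ^ 2 := by field_simp
      _ ≤ _ := this
  have h2' : physHermite (n + 1) y ^ 2 ≤ 4 * t * Wn n * b ^ 2 := by
    have := mul_le_mul_of_nonneg_right h2 (sq_nonneg b)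
    have h3 : physHermite (n + 1) y ^ 2 * t ≤ 4 * t * Wn n * b ^ 2 * t := by
      calc _ = (b ^ 2)⁻¹ * physHermite (n + 1) y ^ 2 * t * b ^ 2 := by field_simp
        _ ≤ _ := this
        _ = _ := by rw [← ht2]; ring
    exact le_of_mul_le_mul_right h3 ht0
  apply abs_le_of_sq_le_sq _ (by positivity)
  have h4 : physHermite n x ^ 2 * s * physHermite (n + 1) y ^ 2 ≤
      2 * Wn n * a ^ 2 * (4 * t * Wn n * b ^ 2) := by gcongr
  have h5 : 2 * Wn n * a ^ 2 * (4 * t * Wn n * b ^ 2) ≤ 2 * Wn n * a ^ 2 * (4 * (2 * s) * Wn n * b ^ 2) := by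
    gcongr
  refine le_of_mul_le_mul_right ?_ hs0
  calc _ = physHermite n x ^ 2 * s * physHermite (n + 1) y ^ 2 := by ring
    _ ≤ _ := h4.trans h5
    _ = _ := by ring

theorem Ker_off_bound (x y : ℝ) (hxy : x ≠ y) (n : ℕ) (hn : 1 ≤ n) (hx : x ^ 2 ≤ n)
    (hy : y ^ 2 ≤ n) :
    |Ker x y n| ≤ 4 * Real.exp (x ^ 2 / 2) * Real.exp (y ^ 2 / 2) / |x - y| := by
  have hd : 0 < |x - y| := abs_pos.2 (sub_ne_zero.2 hxy)
  rw [le_div_iff₀ hd]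
  have h := Ker_CD x y n
  have hW := Wn_pos n
  have h1 := prod_bound n hn x y hx hy
  have h2 := prod_bound n hn y x hy hx
  have h3 : |Ker x y n| * |x - y| * (2 * Wn n) ≤
      (4 * Real.exp (x ^ 2 / 2) * Real.exp (y ^ 2 / 2)) * (2 * Wn n) := by
    have e : |Ker x y n| * |x - y| * (2 * Wn n) = |(x - y) * Ker x y n * (2 * Wn n)| := by
      rw [abs_mul, abs_mul, abs_of_pos (show 0 < 2 * Wn n by positivity)]; ring
    rw [e, h]
    have := abs_sub (physHermite (n + 1) x * physHermite n y) (physHermite n x * physHermite (n + 1) y)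
    rw [mul_comm (physHermite (n + 1) x)] at this ⊢
    linarith
  exact le_of_mul_le_mul_right h3 (by positivity)

theorem Ker_diag_diff (x : ℝ) (n : ℕ) (hn : 1 ≤ n) (hx : x ^ 2 ≤ n) :
    |Real.exp (-x ^ 2) * Ker x x n - Ker 0 0 n| ≤ 4 * |x| := by
  have := Convex.norm_image_sub_le_of_norm_hasDerivWithin_le
    (f := fun t => Real.exp (-t ^ 2) * Ker t t n)
    (f' := fun t => -(Real.exp (-t ^ 2) * (physHermite n t * physHermite (n + 1) t) / Wn n))
    (s := Set.uIcc 0 x) (x := 0) (y := x) (C := 4)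
    (fun t _ => (Ker_diag_deriv n t).hasDerivWithinAt) ?_ (convex_uIcc 0 x)
    Set.left_mem_uIcc Set.right_mem_uIcc
  · simpa using this
  · intro t ht
    have ht2 : t ^ 2 ≤ x ^ 2 := by
      rw [sq_le_sq]
      have := Set.abs_sub_left_of_mem_uIcc ht
      simpa using this
    have hW := Wn_pos n
    have hb := prod_bound n hn t t (ht2.trans hx) (ht2.trans hx)
    rw [Real.norm_eq_abs, abs_neg, abs_div, abs_mul, abs_of_pos hW, Real.abs_exp,
      div_le_iff₀ hW]
    calc _ ≤ Real.exp (-t ^ 2) * (4 * Real.exp (t ^ 2 / 2) * Real.exp (t ^ 2 / 2) * Wn n) := by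
          gcongr
      _ = 4 * Wn n * (Real.exp (-t ^ 2) * Real.exp (t ^ 2 / 2) * Real.exp (t ^ 2 / 2)) := by ring
      _ = _ := by
        rw [← Real.exp_add, ← Real.exp_add, show -t ^ 2 + t ^ 2 / 2 + t ^ 2 / 2 = 0 by ring,
          Real.exp_zero, mul_one]

theorem Ker_zero_even (m : ℕ) : Ker 0 0 (2 * m) = (2 * m + 1) * cb m ∧
    Ker 0 0 (2 * m + 1) = (2 * m + 1) * cb m := by
  have key : ∀ m, Ker 0 0 (2 * m + 1) = Ker 0 0 (2 * m) := by
    intro m; rw [Ker_succ, (pH_even_zero m).2]; simp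
  rw [key, and_self]
  induction m with
  | zero => simp [Ker_zero, cb]
  | succ m ih =>
    have h := (pH_even_zero (m + 1)).1
    rw [show 2 * (m + 1) = 2 * m + 1 + 1 by ring] at h ⊢
    rw [Ker_succ, key, ih, ← pow_two, h, mul_div_assoc, div_self (Wn_pos _).ne']
    simp only [cb]; push_cast
    field_simp

theorem Ker_zero_sq (n : ℕ) :
    Ker 0 0 n = Real.sqrt ((2 * (n / 2 : ℕ) + 1) / Real.Wallis.W (n / 2)) := by
  have hk : Ker 0 0 n = (2 * (n / 2 : ℕ) + 1) * cb (n / 2) := by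
    rcases Nat.even_or_odd' n with ⟨m, h | h⟩
    · rw [show n / 2 = m by omega, h]; exact (Ker_zero_even m).1
    · rw [show n / 2 = m by omega, h]; exact (Ker_zero_even m).2
  have hc := cb_pos (n / 2)
  rw [hk]
  symm
  rw [Real.sqrt_eq_iff_mul_self_eq_of_pos (by positivity)]
  have h := cb_wallis (n / 2)
  have hW := Real.Wallis.W_pos (n / 2)
  rw [eq_div_iff hW.ne']
  calc _ = (2 * ((n / 2 : ℕ) : ℝ) + 1) * (cb (n / 2) ^ 2 * (2 * ((n / 2 : ℕ) : ℝ) + 1) * Real.Wallis.W (n / 2)) := by ring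
    _ = _ := by rw [h, mul_one]

theorem Ker_zero_tendsto :
    Tendsto (fun n : ℕ => Ker 0 0 n / Real.sqrt n) atTop (𝓝 (Real.sqrt (2 / Real.pi))) := by
  have h1 : Tendsto (fun n : ℕ => Real.Wallis.W (n / 2)) atTop (𝓝 (Real.pi / 2)) :=
    Real.Wallis.tendsto_W_nhds_pi_div_two.comp (Nat.tendsto_div_const_atTop (by norm_num))
  have h2 : Tendsto (fun n : ℕ => (2 * ((n / 2 : ℕ) : ℝ) + 1) / n) atTop (𝓝 1) := by
    have h3 : Tendsto (fun n : ℕ => 1 + 1 / (n : ℝ)) atTop (𝓝 1) := by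
      simpa using tendsto_one_div_atTop_nhds_zero_nat.const_add (1 : ℝ)
    refine tendsto_of_tendsto_of_tendsto_of_le_of_le' tendsto_const_nhds h3 ?_ ?_
    · filter_upwards [eventually_ge_atTop 1] with n hn
      have : (0 : ℝ) < n := by exact_mod_cast hn
      rw [le_div_iff₀ this, one_mul]
      have : n ≤ 2 * (n / 2) + 1 := by omega
      exact_mod_cast this
    · filter_upwards [eventually_ge_atTop 1] with n hn
      have h0 : (0 : ℝ) < n := by exact_mod_cast hn
      rw [div_le_iff₀ h0, add_mul, one_div, inv_mul_cancel₀ h0.ne']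
      have : 2 * (n / 2) + 1 ≤ 1 * n + 1 := by omega
      exact_mod_cast this
  have h4 := (h2.div h1 (by positivity)).sqrt
  rw [one_div_div] at h4
  refine h4.congr' ?_
  filter_upwards with n
  rw [Ker_zero_sq, ← Real.sqrt_div' _ (by positivity)]
  congr 1
  simp only [Pi.div_apply]
  ring

theorem Ker_diag_tendsto (x : ℝ) :
    Tendsto (fun n : ℕ => Ker x x n / Real.sqrt n) atTop
      (𝓝 (Real.exp (x ^ 2) * Real.sqrt (2 / Real.pi))) := by
  have h1 : Tendsto (fun n : ℕ => (Real.exp (-x ^ 2) * Ker x x n - Ker 0 0 n) / Real.sqrt n)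
      atTop (𝓝 0) := by
    have hs : Tendsto (fun n : ℕ => 4 * |x| / Real.sqrt n) atTop (𝓝 0) :=
      tendsto_const_nhds.div_atTop (Real.tendsto_sqrt_atTop.comp tendsto_natCast_atTop_atTop)
    refine squeeze_zero_norm' ?_ hs
    filter_upwards [eventually_ge_atTop 1, eventually_ge_atTop ⌈x ^ 2⌉₊] with n hn hn2
    rw [norm_div, Real.norm_eq_abs, Real.norm_of_nonneg (Real.sqrt_nonneg _)]
    gcongr
    exact Ker_diag_diff x n hn (Nat.ceil_le.1 hn2)
  have h2 := (h1.add Ker_zero_tendsto).const_mul (Real.exp (x ^ 2))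
  rw [zero_add] at h2
  refine h2.congr ?_
  intro n
  have : Real.exp (x ^ 2) * Real.exp (-x ^ 2) = 1 := by rw [← Real.exp_add]; simp
  rw [← add_div, sub_add_cancel, ← mul_div_assoc, ← mul_assoc, this, one_mul]

/-- Abel summation. -/
theorem abel_bound (S B g : ℕ → ℝ) (N : ℕ) (hS : ∀ n, N ≤ n → |S n| ≤ B n)
    (hg : ∀ n : ℕ, N ≤ n → B (n + 1) * (1 / ((n : ℝ) + 1) - 1 / ((n : ℝ) + 2)) ≤ g n - g (n + 1))
    (hB : ∀ n : ℕ, N ≤ n → B n / ((n : ℝ) + 1) ≤ g n) (M : ℕ) :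
    |∑ k ∈ Finset.range M, (S (k + N + 1) - S (k + N)) / ((k + N + 1 : ℕ) : ℝ)| ≤ 2 * g N := by
  have key : ∀ M : ℕ, |∑ k ∈ Finset.range M, (S (k + N + 1) - S (k + N)) / ((k + N + 1 : ℕ) : ℝ)
      - S (M + N) / ((M + N : ℕ) + 1 : ℝ) + S N / ((N : ℝ) + 1)| ≤ g N - g (M + N) := by
    intro M
    induction M with
    | zero => simp
    | succ M ih =>
      have h1 := hg (M + N) (by omega)
      have h2 := hS (M + N + 1) (by omega)
      have h3 : (0 : ℝ) ≤ 1 / (((M + N : ℕ) : ℝ) + 1) - 1 / (((M + N : ℕ) : ℝ) + 2) := by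
        rw [sub_nonneg]; gcongr; norm_num
      have h4 := mul_le_mul_of_nonneg_right h2 h3
      rw [show M + 1 + N = M + N + 1 by ring, Finset.sum_range_succ]
      have e : ∑ k ∈ Finset.range M, (S (k + N + 1) - S (k + N)) / ((k + N + 1 : ℕ) : ℝ)
          + (S (M + N + 1) - S (M + N)) / ((M + N + 1 : ℕ) : ℝ)
          - S (M + N + 1) / ((M + N + 1 : ℕ) + 1 : ℝ) + S N / ((N : ℝ) + 1)
        = (∑ k ∈ Finset.range M, (S (k + N + 1) - S (k + N)) / ((k + N + 1 : ℕ) : ℝ)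
          - S (M + N) / ((M + N : ℕ) + 1 : ℝ) + S N / ((N : ℝ) + 1))
          + S (M + N + 1) * (1 / (((M + N : ℕ) : ℝ) + 1) - 1 / (((M + N : ℕ) : ℝ) + 2)) := by
        rw [show (((M + N + 1 : ℕ) : ℝ) + 1) = ((M + N : ℕ) : ℝ) + 2 by push_cast; ring,
          show (((M + N + 1 : ℕ) : ℝ)) = ((M + N : ℕ) : ℝ) + 1 by push_cast; ring]
        ring
      rw [e]
      refine (abs_add_le _ _).trans ?_
      rw [abs_mul, abs_of_nonneg h3]
      linarith
  have h := key M
  have a1 : |S (M + N) / ((M + N : ℕ) + 1 : ℝ)| ≤ g (M + N) := by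
    rw [abs_div, abs_of_pos (show (0 : ℝ) < ((M + N : ℕ) + 1 : ℝ) by positivity)]
    refine le_trans ?_ (hB (M + N) (by omega))
    gcongr
    exact hS _ (by omega)
  have a2 : |S N / ((N : ℝ) + 1)| ≤ g N := by
    rw [abs_div, abs_of_pos (show (0 : ℝ) < (N : ℝ) + 1 by positivity)]
    refine le_trans ?_ (hB N le_rfl)
    gcongr
    exact hS _ le_rfl
  rw [abs_le] at *
  constructor <;> linarith [h.1, h.2, a1.1, a1.2, a2.1, a2.2]

theorem abel_const (S : ℕ → ℝ) (C : ℝ) (N : ℕ) (hS : ∀ n, N ≤ n → |S n| ≤ C) (M : ℕ) :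
    |∑ k ∈ Finset.range M, (S (k + N + 1) - S (k + N)) / ((k + N + 1 : ℕ) : ℝ)|
      ≤ 2 * (C / ((N : ℝ) + 1)) := by
  refine abel_bound S (fun _ => C) (fun n => C / ((n : ℝ) + 1)) N hS ?_ (fun _ _ => le_rfl) M
  intro n _
  apply le_of_eq
  push_cast
  ring

theorem sqrt_tele (n : ℕ) : (1 / ((n : ℝ) + 1) - 1 / ((n : ℝ) + 2)) * Real.sqrt ((n : ℝ) + 1) ≤
    2 * (1 / Real.sqrt ((n : ℝ) + 1) - 1 / Real.sqrt ((n : ℝ) + 2)) := by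
  set s := Real.sqrt ((n : ℝ) + 1) with hs
  set t := Real.sqrt ((n : ℝ) + 2) with ht
  have hs2 : s ^ 2 = n + 1 := Real.sq_sqrt (by positivity)
  have ht2 : t ^ 2 = n + 2 := Real.sq_sqrt (by positivity)
  have hs0 : 0 < s := Real.sqrt_pos.2 (by positivity)
  have ht0 : 0 < t := Real.sqrt_pos.2 (by positivity)
  have hst : s ≤ t := Real.sqrt_le_sqrt (by linarith)
  rw [← hs2, ← ht2]
  have e : 2 * (1 / s - 1 / t) - (1 / s ^ 2 - 1 / t ^ 2) * s = (t - s) ^ 2 / (s * t ^ 2) := by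
    field_simp; ring
  have : 0 ≤ (t - s) ^ 2 / (s * t ^ 2) := by positivity
  linarith

theorem abel_sqrt (S : ℕ → ℝ) (ε : ℝ) (hε : 0 ≤ ε) (N : ℕ)
    (hS : ∀ n : ℕ, N ≤ n → |S n| ≤ ε * Real.sqrt n) (M : ℕ) :
    |∑ k ∈ Finset.range M, (S (k + N + 1) - S (k + N)) / ((k + N + 1 : ℕ) : ℝ)|
      ≤ 2 * (2 * ε / Real.sqrt ((N : ℝ) + 1)) := by
  refine abel_bound S (fun n => ε * Real.sqrt n) (fun n => 2 * ε / Real.sqrt ((n : ℝ) + 1))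
    N hS ?_ ?_ M
  · intro n _
    have := mul_le_mul_of_nonneg_left (sqrt_tele n) hε
    push_cast
    rw [show (n : ℝ) + 1 + 1 = n + 2 by ring]
    calc _ = ε * ((1 / ((n : ℝ) + 1) - 1 / ((n : ℝ) + 2)) * Real.sqrt ((n : ℝ) + 1)) := by ring
      _ ≤ _ := this
      _ = _ := by ring
  · intro n _
    have h0 : 0 < Real.sqrt ((n : ℝ) + 1) := Real.sqrt_pos.2 (by positivity)
    have h1 : Real.sqrt n ≤ Real.sqrt ((n : ℝ) + 1) := Real.sqrt_le_sqrt (by linarith)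
    have h2 : Real.sqrt ((n : ℝ) + 1) ^ 2 = n + 1 := Real.sq_sqrt (by positivity)
    have h3 : ε * Real.sqrt n / ((n : ℝ) + 1) ≤ ε / Real.sqrt ((n : ℝ) + 1) := by
      rw [div_le_div_iff₀ (by positivity) h0]
      have := mul_le_mul_of_nonneg_left h1 (mul_nonneg hε h0.le)
      calc _ = ε * Real.sqrt ((n : ℝ) + 1) * Real.sqrt n := by ring
        _ ≤ _ := this
        _ = ε * Real.sqrt ((n : ℝ) + 1) ^ 2 := by ring
        _ = _ := by rw [h2]
    have h4 : ε / Real.sqrt ((n : ℝ) + 1) ≤ 2 * ε / Real.sqrt ((n : ℝ) + 1) := by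
      gcongr; linarith
    exact h3.trans h4

theorem sqrt_term (n : ℕ) (hn : 1 ≤ n) :
    1 / Real.sqrt ((n : ℝ) + 1) - 1 / Real.sqrt ((n : ℝ) + 2) ≤
      (Real.sqrt ((n : ℝ) + 1) - Real.sqrt n) / ((n : ℝ) + 1) ∧
    (Real.sqrt ((n : ℝ) + 1) - Real.sqrt n) / ((n : ℝ) + 1) ≤
      1 / Real.sqrt n - 1 / Real.sqrt ((n : ℝ) + 1) := by
  have hn' : (1 : ℝ) ≤ n := by exact_mod_cast hn
  set r := Real.sqrt (n : ℝ) with hr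
  set s := Real.sqrt ((n : ℝ) + 1) with hs
  set t := Real.sqrt ((n : ℝ) + 2) with ht
  have hr2 : r ^ 2 = n := Real.sq_sqrt (by positivity)
  have hs2 : s ^ 2 = n + 1 := Real.sq_sqrt (by positivity)
  have ht2 : t ^ 2 = n + 2 := Real.sq_sqrt (by positivity)
  have hr0 : 0 < r := Real.sqrt_pos.2 (by positivity)
  have hs0 : 0 < s := Real.sqrt_pos.2 (by positivity)
  have ht0 : 0 < t := Real.sqrt_pos.2 (by positivity)
  have hst : s ≤ t := Real.sqrt_le_sqrt (by linarith)
  have hrs : r ≤ s := Real.sqrt_le_sqrt (by linarith)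
  rw [← hs2]
  constructor
  · have h1 : t - s ≤ s - r := by
      have a : (t - s) * (t + s) = 1 := by nlinarith
      have b : (s - r) * (s + r) = 1 := by nlinarith
      by_contra! hc
      have : (s - r) * (s + r) < (t - s) * (t + s) := by
        apply mul_lt_mul'' hc <;> linarith
      linarith
    rw [div_sub_div _ _ hs0.ne' ht0.ne', div_le_div_iff₀ (by positivity) (by positivity)]
    have : (1 * t - s * 1) * s ^ 2 ≤ (s - r) * s ^ 2 :=
      mul_le_mul_of_nonneg_right (by linarith) (by positivity)
    refine this.trans ?_
    have h5 : s ^ 2 ≤ s * t := by nlinarith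
    exact mul_le_mul_of_nonneg_left h5 (by linarith)
  · rw [div_sub_div _ _ hr0.ne' hs0.ne', div_le_div_iff₀ (by positivity) (by positivity)]
    have h5 : r * s ≤ s ^ 2 := by nlinarith
    have := mul_le_mul_of_nonneg_left h5 (show 0 ≤ s - r by linarith)
    linarith

theorem sqrt_sum (N : ℕ) (hN : 1 ≤ N) (M : ℕ) :
    1 / Real.sqrt ((N : ℝ) + 1) - 1 / Real.sqrt (((M + N : ℕ) : ℝ) + 1) ≤
      ∑ k ∈ Finset.range M, (Real.sqrt ((k + N + 1 : ℕ) : ℝ) - Real.sqrt ((k + N : ℕ) : ℝ)) /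
        ((k + N + 1 : ℕ) : ℝ) ∧
    ∑ k ∈ Finset.range M, (Real.sqrt ((k + N + 1 : ℕ) : ℝ) - Real.sqrt ((k + N : ℕ) : ℝ)) /
        ((k + N + 1 : ℕ) : ℝ) ≤ 1 / Real.sqrt N - 1 / Real.sqrt ((M + N : ℕ) : ℝ) := by
  induction M with
  | zero => simp
  | succ M ih =>
    have h := sqrt_term (M + N) (by omega)
    rw [Finset.sum_range_succ, show M + 1 + N = M + N + 1 by ring,
      show (((M + N + 1 : ℕ) : ℝ) + 1) = ((M + N : ℕ) : ℝ) + 2 by push_cast; ring,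
      show (((M + N + 1 : ℕ) : ℝ)) = ((M + N : ℕ) : ℝ) + 1 by push_cast; ring]
    constructor <;> linarith [ih.1, ih.2, h.1, h.2]

/-- Tail term of the series, up to constants. -/
theorem term_summable (x y : ℝ) :
    Summable (fun n : ℕ => physHermite n x * physHermite n y / Wn n / (n : ℝ)) := by
  have hs : Summable (fun n : ℕ => (2 * Real.exp (x ^ 2) + 2 * Real.exp (y ^ 2)) *
      (1 / (n : ℝ) ^ (3 / 2 : ℝ))) :=
    (Real.summable_one_div_nat_rpow.2 (by norm_num)).mul_left _
  refine Summable.of_norm_bounded_eventually_nat hs ?_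
  filter_upwards [eventually_ge_atTop 1, eventually_ge_atTop ⌈x ^ 2⌉₊,
    eventually_ge_atTop ⌈y ^ 2⌉₊] with n hn hx hy
  have one : ∀ z : ℝ, z ^ 2 ≤ n → physHermite n z ^ 2 * Real.sqrt n ≤
      2 * Real.exp (z ^ 2) * Wn n := by
    intro z hz
    have h := mul_le_mul_of_nonneg_left (pH_bound n hn z hz) (Real.exp_pos (z ^ 2)).le
    have e : Real.exp (z ^ 2) * Real.exp (-z ^ 2) = 1 := by rw [← Real.exp_add]; simp
    calc _ = (Real.exp (z ^ 2) * Real.exp (-z ^ 2)) * physHermite n z ^ 2 * Real.sqrt n := by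
          rw [e, one_mul]
      _ = _ := by ring
      _ ≤ _ := h
      _ = _ := by ring
  have h1 := one x (Nat.ceil_le.1 hx)
  have h2 := one y (Nat.ceil_le.1 hy)
  have hn0 : (0 : ℝ) < n := by exact_mod_cast hn
  have hW := Wn_pos n
  have hs0 : 0 < Real.sqrt n := Real.sqrt_pos.2 hn0
  have e3 : (n : ℝ) ^ (3 / 2 : ℝ) = n * Real.sqrt n := by
    rw [Real.sqrt_eq_rpow, ← Real.rpow_one_add' hn0.le (by norm_num)]; norm_num
  rw [e3, Real.norm_eq_abs, abs_div, abs_div, abs_of_pos hW, abs_of_pos hn0, abs_mul, div_div,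
    mul_one_div, div_le_div_iff₀ (by positivity) (by positivity)]
  have h3 : |physHermite n x| * |physHermite n y| ≤ physHermite n x ^ 2 + physHermite n y ^ 2 := by
    rw [← sq_abs (physHermite n x), ← sq_abs (physHermite n y)]
    nlinarith [sq_nonneg (|physHermite n x| - |physHermite n y|),
      sq_nonneg (|physHermite n x| + |physHermite n y|)]
  have h4 : |physHermite n x| * |physHermite n y| * Real.sqrt n ≤
      (2 * Real.exp (x ^ 2) + 2 * Real.exp (y ^ 2)) * Wn n := by
    have := mul_le_mul_of_nonneg_right h3 hs0.le
    linarith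
  have := mul_le_mul_of_nonneg_right h4 hn0.le
  linarith

noncomputable def Tail (x y : ℝ) (N : ℕ) : ℝ :=
  ∑' k : ℕ, (Ker x y (k + N + 1) - Ker x y (k + N)) / ((k + N + 1 : ℕ) : ℝ)

theorem Tail_tendsto (x y : ℝ) (N : ℕ) :
    Tendsto (fun M => ∑ k ∈ Finset.range M,
      (Ker x y (k + N + 1) - Ker x y (k + N)) / ((k + N + 1 : ℕ) : ℝ)) atTop (𝓝 (Tail x y N)) := by
  have h : Summable (fun k : ℕ => (Ker x y (k + N + 1) - Ker x y (k + N)) / ((k + N + 1 : ℕ) : ℝ)) := by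
    have := (summable_nat_add_iff (N + 1)).2 (term_summable x y)
    refine this.congr ?_
    intro k
    rw [Ker_succ, add_sub_cancel_left]
    rfl
  exact h.hasSum.tendsto_sum_nat

theorem tsum_eq_Tail (x y : ℝ) (N : ℕ) :
    ∑' n : ℕ, physHermite (n + N + 1) x * physHermite (n + N + 1) y /
      (2 * ((n + N + 1 : ℕ) : ℝ) * 2 ^ (n + N + 1) *
        ((n + N + 1).factorial : ℝ) * Real.sqrt Real.pi) =
      Tail x y N * (1 / (2 * Real.sqrt Real.pi)) := by
  unfold Tail
  rw [← tsum_mul_right]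
  congr 1
  ext k
  rw [Ker_succ, add_sub_cancel_left]
  unfold Wn
  rw [div_div, div_mul_div_comm, mul_one]
  congr 1
  ring

theorem Tail_off (x y : ℝ) (hxy : x ≠ y) (γ : ℝ) (hγ : γ < 1) :
    Tendsto (fun N : ℕ => (N : ℝ) ^ γ * Tail x y N) atTop (𝓝 0) := by
  set C := 4 * Real.exp (x ^ 2 / 2) * Real.exp (y ^ 2 / 2) / |x - y| with hC
  have hC0 : 0 ≤ C := by positivity
  have hlim : Tendsto (fun N : ℕ => 2 * C * (N : ℝ) ^ (-(1 - γ))) atTop (𝓝 0) := by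
    have := ((tendsto_rpow_neg_atTop (sub_pos.2 hγ)).comp
      (tendsto_natCast_atTop_atTop (R := ℝ))).const_mul (2 * C)
    simpa using this
  refine squeeze_zero_norm' ?_ hlim
  filter_upwards [eventually_ge_atTop 1, eventually_ge_atTop ⌈x ^ 2⌉₊,
    eventually_ge_atTop ⌈y ^ 2⌉₊] with N hN hx hy
  have hb : |Tail x y N| ≤ 2 * (C / ((N : ℝ) + 1)) := by
    refine le_of_tendsto (Tail_tendsto x y N).abs (Eventually.of_forall fun M => ?_)
    refine abel_const (Ker x y) C N ?_ M
    intro n hn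
    exact Ker_off_bound x y hxy n (hN.trans hn) (Nat.ceil_le.1 (hx.trans hn))
      (Nat.ceil_le.1 (hy.trans hn))
  have hN0 : (0 : ℝ) < N := by exact_mod_cast hN
  have hb2 : |Tail x y N| ≤ 2 * (C / N) := by
    refine hb.trans ?_
    gcongr
    linarith
  rw [norm_mul, Real.norm_eq_abs, Real.norm_eq_abs, abs_of_nonneg (by positivity),
    show -(1 - γ) = γ - 1 by ring, Real.rpow_sub_one hN0.ne']
  calc _ ≤ (N : ℝ) ^ γ * (2 * (C / N)) := by gcongr
    _ = _ := by ring

theorem Tail_diag (x : ℝ) :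
    Tendsto (fun N : ℕ => Real.sqrt N * Tail x x N) atTop
      (𝓝 (Real.exp (x ^ 2) * Real.sqrt (2 / Real.pi))) := by
  set c := Real.exp (x ^ 2) * Real.sqrt (2 / Real.pi) with hc
  have hc0 : 0 ≤ c := by positivity
  have hK : Tendsto (fun n : ℕ => Ker x x n / Real.sqrt n) atTop (𝓝 c) := Ker_diag_tendsto x
  have hratio : Tendsto (fun N : ℕ => c * (Real.sqrt N / Real.sqrt ((N : ℝ) + 1))) atTop (𝓝 c) := by
    have h := (tendsto_natCast_div_add_atTop (1 : ℝ)).sqrt.const_mul c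
    simp only [Real.sqrt_one, mul_one] at h
    refine h.congr ?_
    intro n
    rw [Real.sqrt_div (by positivity)]
  rw [Metric.tendsto_atTop]
  intro δ hδ
  set ε := δ / 10 with hε
  have hε0 : 0 < ε := by positivity
  obtain ⟨N1, hN1⟩ := (Metric.tendsto_atTop.1 hK) ε hε0
  obtain ⟨N2, hN2⟩ := (Metric.tendsto_atTop.1 hratio) ε hε0
  refine ⟨max 1 (max N1 N2), fun N hN => ?_⟩
  have hn1 : 1 ≤ N := le_trans (le_max_left _ _) hN
  have hn2 : N1 ≤ N := le_trans (le_trans (le_max_left _ _) (le_max_right _ _)) hN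
  have hn3 : N2 ≤ N := le_trans (le_trans (le_max_right _ _) (le_max_right _ _)) hN
  have hr := hN2 N hn3
  have hS : ∀ n : ℕ, N ≤ n → |Ker x x n - c * Real.sqrt n| ≤ ε * Real.sqrt n := by
    intro n hn
    have h := (hN1 n (hn2.trans hn)).le
    have hpos : 0 < Real.sqrt n := Real.sqrt_pos.2 (by exact_mod_cast (by omega : 0 < n))
    rw [Real.dist_eq] at h
    calc _ = |Ker x x n / Real.sqrt n - c| * Real.sqrt n := by
          rw [← abs_of_pos hpos, ← abs_mul, abs_of_pos hpos]; congr 1; field_simp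
      _ ≤ _ := by gcongr
  have hA := abel_sqrt (fun n => Ker x x n - c * Real.sqrt n) ε hε0.le N hS
  have hQ := sqrt_sum N hn1
  set D := 2 * (2 * ε / Real.sqrt ((N : ℝ) + 1)) with hD
  have split : ∀ M, ∑ k ∈ Finset.range M, ((Ker x x (k + N + 1) - c * Real.sqrt ((k + N + 1 : ℕ) : ℝ)) -
      (Ker x x (k + N) - c * Real.sqrt ((k + N : ℕ) : ℝ))) / ((k + N + 1 : ℕ) : ℝ) =
      ∑ k ∈ Finset.range M, (Ker x x (k + N + 1) - Ker x x (k + N)) / ((k + N + 1 : ℕ) : ℝ) -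
      c * ∑ k ∈ Finset.range M, (Real.sqrt ((k + N + 1 : ℕ) : ℝ) - Real.sqrt ((k + N : ℕ) : ℝ)) /
        ((k + N + 1 : ℕ) : ℝ) := by
    intro M
    rw [Finset.mul_sum, ← Finset.sum_sub_distrib]
    apply Finset.sum_congr rfl
    intro k _
    ring
  have up : Tail x x N ≤ D + c * (1 / Real.sqrt N) := by
    refine le_of_tendsto (Tail_tendsto x x N) (Eventually.of_forall fun M => ?_)
    have h := hA M
    rw [split] at h
    have h1 := (abs_le.1 h).2
    have h2 : c * ∑ k ∈ Finset.range M, (Real.sqrt ((k + N + 1 : ℕ) : ℝ) - Real.sqrt ((k + N : ℕ) : ℝ)) /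
        ((k + N + 1 : ℕ) : ℝ) ≤ c * (1 / Real.sqrt N) := by
      gcongr
      have : 0 ≤ 1 / Real.sqrt ((M + N : ℕ) : ℝ) := by positivity
      linarith [(hQ M).2]
    linarith
  have low : -D + c * (1 / Real.sqrt ((N : ℝ) + 1)) ≤ Tail x x N := by
    have hl : Tendsto (fun M : ℕ => -D + c * (1 / Real.sqrt ((N : ℝ) + 1) -
        1 / Real.sqrt (((M + N : ℕ) : ℝ) + 1))) atTop
        (𝓝 (-D + c * (1 / Real.sqrt ((N : ℝ) + 1) - 0))) := by
      refine ((tendsto_const_nhds.sub ?_).const_mul c).const_add (-D)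
      refine tendsto_const_nhds.div_atTop (Real.tendsto_sqrt_atTop.comp ?_)
      exact tendsto_atTop_add_const_right _ _
        (tendsto_natCast_atTop_atTop.comp (tendsto_add_atTop_nat N))
    rw [sub_zero] at hl
    refine le_of_tendsto_of_tendsto hl (Tail_tendsto x x N) (Eventually.of_forall fun M => ?_)
    have h := hA M
    rw [split] at h
    have h1 := (abs_le.1 h).1
    have h2 := mul_le_mul_of_nonneg_left (hQ M).1 hc0
    simp only
    linarith
  have hs0 : 0 < Real.sqrt N := Real.sqrt_pos.2 (by exact_mod_cast hn1)
  have ht0 : 0 < Real.sqrt ((N : ℝ) + 1) := Real.sqrt_pos.2 (by positivity)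
  have hst : Real.sqrt N ≤ Real.sqrt ((N : ℝ) + 1) := Real.sqrt_le_sqrt (by linarith)
  have hDs : Real.sqrt N * D ≤ 4 * ε := by
    rw [hD]
    have : Real.sqrt N / Real.sqrt ((N : ℝ) + 1) ≤ 1 := (div_le_one ht0).2 hst
    calc _ = 4 * ε * (Real.sqrt N / Real.sqrt ((N : ℝ) + 1)) := by ring
      _ ≤ 4 * ε * 1 := by gcongr
      _ = _ := by ring
  have u2 := mul_le_mul_of_nonneg_left up hs0.le
  have l2 := mul_le_mul_of_nonneg_left low hs0.le
  have e1 : Real.sqrt N * (D + c * (1 / Real.sqrt N)) = Real.sqrt N * D + c := by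
    field_simp
  have e2 : Real.sqrt N * (-D + c * (1 / Real.sqrt ((N : ℝ) + 1))) =
      -(Real.sqrt N * D) + c * (Real.sqrt N / Real.sqrt ((N : ℝ) + 1)) := by ring
  rw [e1] at u2
  rw [e2] at l2
  rw [Real.dist_eq, abs_lt] at hr ⊢
  have : δ = 10 * ε := by rw [hε]; ring
  constructor <;> linarith [hr.1, hr.2]

/-- Asymptotic error in the eigenfunction expansion of the Green's function associated
with the Hermite polynomials: on-diagonal limit with scaling `√N` and off-diagonal
vanishing for every scaling exponent `γ < 1`. -/
theorem truncated_green_hermite_asymptotics :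
    (∀ x : ℝ,
      Tendsto
        (fun N : ℕ => Real.sqrt N *
          ∑' n : ℕ,
            physHermite (n + N + 1) x ^ 2 /
              (2 * ((n + N + 1 : ℕ) : ℝ) * 2 ^ (n + N + 1) *
                ((n + N + 1).factorial : ℝ) * Real.sqrt Real.pi))
        atTop (nhds (Real.exp (x ^ 2) / (Real.sqrt 2 * Real.pi)))) ∧
    (∀ x y : ℝ, x ≠ y → ∀ γ : ℝ, γ < 1 →
      Tendsto
        (fun N : ℕ => (N : ℝ) ^ γ *
          ∑' n : ℕ,
            physHermite (n + N + 1) x * physHermite (n + N + 1) y /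
              (2 * ((n + N + 1 : ℕ) : ℝ) * 2 ^ (n + N + 1) *
                ((n + N + 1).factorial : ℝ) * Real.sqrt Real.pi))
        atTop (nhds 0)) := by
  constructor
  · intro x
    have h := (Tail_diag x).mul_const (1 / (2 * Real.sqrt Real.pi))
    have e : Real.exp (x ^ 2) * Real.sqrt (2 / Real.pi) * (1 / (2 * Real.sqrt Real.pi)) =
        Real.exp (x ^ 2) / (Real.sqrt 2 * Real.pi) := by
      have hp : Real.sqrt Real.pi ^ 2 = Real.pi := Real.sq_sqrt Real.pi_pos.le
      have h2 : Real.sqrt 2 ^ 2 = 2 := Real.sq_sqrt (by norm_num)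
      have hp0 : 0 < Real.sqrt Real.pi := Real.sqrt_pos.2 Real.pi_pos
      have h20 : 0 < Real.sqrt 2 := Real.sqrt_pos.2 (by norm_num)
      rw [Real.sqrt_div (by norm_num), mul_assoc, div_mul_div_comm, div_eq_mul_one_div (Real.exp (x ^ 2))]
      congr 1
      rw [div_eq_div_iff (by positivity) (by positivity)]
      linear_combination Real.pi * h2 - 2 * hp
    rw [e] at h
    refine h.congr ?_
    intro N
    simp_rw [pow_two (physHermite _ x)]
    rw [tsum_eq_Tail]; ring
  · intro x y hxy γ hγ
    have h := (Tail_off x y hxy γ hγ).mul_const (1 / (2 * Real.sqrt Real.pi))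
    rw [zero_mul] at h
    refine h.congr ?_
    intro N
    rw [tsum_eq_Tail]; ring
end

section
/- Fix α ∈ ℝ with α > −1. For every x ∈ (0,∞), lim_{N→∞} √N · Σ_{n=N+1}^∞ Γ(n)·L_n^{(α)}(x)² / Γ(n+α+1) = x^{−α−1/2}·e^x / π. Moreover, for all x, y ∈ (0,∞) with x ≠ y and every real γ < 1/2, lim_{N→∞} N^γ · Σ_{n=N+1}^∞ Γ(n)·L_n^{(α)}(x)·L_n^{(α)}(y) / Γ(n+α+1) = 0. -/
open Filter Topology

/-- The associated Laguerre polynomials `L_n^{(α)}`. -/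
noncomputable def assocLaguerre (α : ℝ) (n : ℕ) (x : ℝ) : ℝ :=
  ∑ k ∈ Finset.range (n + 1),
    (-1 : ℝ) ^ k *
      (Real.Gamma ((n : ℝ) + α + 1) /
        (Real.Gamma ((k : ℝ) + α + 1) * ((n - k).factorial : ℝ) * (k.factorial : ℝ))) * x ^ k

theorem gam_pos {β : ℝ} (hβ : -1 < β) (k : ℕ) : 0 < Real.Gamma ((k : ℝ) + β + 1) := by
  apply Real.Gamma_pos_of_pos
  have : (0 : ℝ) ≤ k := Nat.cast_nonneg k
  linarith

theorem gam_succ {β : ℝ} (hβ : -1 < β) (k : ℕ) :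
    Real.Gamma ((k : ℝ) + β + 1 + 1) = ((k : ℝ) + β + 1) * Real.Gamma ((k : ℝ) + β + 1) := by
  have : (0 : ℝ) ≤ k := Nat.cast_nonneg k
  rw [Real.Gamma_add_one (by linarith)]

/-- coefficients with the binomial form, valid for all `k`. -/
theorem lag_choose (β : ℝ) (n : ℕ) (x : ℝ) :
    assocLaguerre β n x = ∑ k ∈ Finset.range (n + 1),
      ((n.choose k : ℝ) * Real.Gamma ((n : ℝ) + β + 1) /
        (Real.Gamma ((k : ℝ) + β + 1) * n.factorial)) * (-x) ^ k := by
  unfold assocLaguerre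
  refine Finset.sum_congr rfl fun k hk => ?_
  have hk' : k ≤ n := by simpa [Nat.lt_succ_iff] using hk
  rw [Nat.cast_choose ℝ hk', neg_pow x]
  have h1 : (n.factorial : ℝ) ≠ 0 := by positivity
  by_cases hG : Real.Gamma ((k : ℝ) + β + 1) = 0
  · simp [hG]
  field_simp

theorem lag_rec {β : ℝ} (hβ : -1 < β) (m : ℕ) (x : ℝ) :
    ((m : ℝ) + 1) * assocLaguerre β (m + 1) x =
      (β + 1) * assocLaguerre (β + 1) m x - x * assocLaguerre (β + 2) m x := by
  rw [lag_choose, lag_choose, lag_choose, Finset.sum_range_succ']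
  have e1 : ∑ k ∈ Finset.range (m + 1), ((m.choose k : ℝ) * Real.Gamma ((m : ℝ) + (β + 1) + 1) /
        (Real.Gamma ((k : ℝ) + (β + 1) + 1) * m.factorial)) * (-x) ^ k =
      ∑ k ∈ Finset.range (m + 1), ((m.choose (k+1) : ℝ) * Real.Gamma ((m : ℝ) + (β + 1) + 1) /
        (Real.Gamma (((k+1 : ℕ) : ℝ) + (β + 1) + 1) * m.factorial)) * (-x) ^ (k+1) +
       ((m.choose 0 : ℝ) * Real.Gamma ((m : ℝ) + (β + 1) + 1) /
        (Real.Gamma (((0 : ℕ) : ℝ) + (β + 1) + 1) * m.factorial)) * (-x) ^ 0 := by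
    refine Eq.trans ?_ (Finset.sum_range_succ' (fun k : ℕ => ((m.choose k : ℝ) *
      Real.Gamma ((m : ℝ) + (β + 1) + 1) /
        (Real.Gamma ((k : ℝ) + (β + 1) + 1) * m.factorial)) * (-x) ^ k) (m + 1))
    rw [Finset.sum_range_succ _ (m+1)]
    simp
  rw [e1, mul_add, mul_add, Finset.mul_sum, Finset.mul_sum, Finset.mul_sum]
  have hm : (m.factorial : ℝ) ≠ 0 := by positivity
  have hb : β + 1 ≠ 0 := by linarith
  have e0 : ((m : ℝ) + 1) * (((m + 1).choose 0 : ℝ) * Real.Gamma (((m + 1 : ℕ) : ℝ) + β + 1) /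
        (Real.Gamma (((0 : ℕ) : ℝ) + β + 1) * (m + 1).factorial) * (-x) ^ 0) =
      (β + 1) * (((m.choose 0 : ℝ) * Real.Gamma ((m : ℝ) + (β + 1) + 1) /
        (Real.Gamma (((0 : ℕ) : ℝ) + (β + 1) + 1) * m.factorial)) * (-x) ^ 0) := by
    have h0 := gam_succ hβ 0
    have h0p := gam_pos hβ 0
    rw [Nat.factorial_succ]
    rw [show ((0 : ℕ) : ℝ) + (β + 1) + 1 = ((0 : ℕ) : ℝ) + β + 1 + 1 by ring, h0,
      show (((m + 1 : ℕ) : ℝ) + β + 1) = ((m : ℝ) + (β + 1) + 1) by push_cast; ring]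
    push_cast
    have : Real.Gamma (((0 : ℕ) : ℝ) + β + 1) ≠ 0 := h0p.ne'
    push_cast at this
    simp only [Nat.choose_zero_right, pow_zero, zero_add] at *
    have hm1 : (m : ℝ) + 1 ≠ 0 := by positivity
    field_simp
  rw [e0, add_sub_right_comm, ← Finset.sum_sub_distrib]
  congr 1
  refine Finset.sum_congr rfl fun k _ => ?_
  have hk := gam_succ (show -1 < β by linarith) (k + 1)
  have hkp := gam_pos (show -1 < β by linarith) (k + 1)
  have hm1 := gam_succ (show -1 < β by linarith) (m + 1)
  have hch : (((m + 1).choose (k + 1) : ℕ) : ℝ) * (k + 1) = (m + 1) * (m.choose k : ℝ) := by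
    have := Nat.add_one_mul_choose_eq m k
    exact_mod_cast this.symm
  have hch2 : ((m.choose (k + 1) : ℕ) : ℝ) = ((m + 1).choose (k + 1) : ℕ) - (m.choose k : ℕ) := by
    rw [Nat.choose_succ_succ' m k]; push_cast; ring
  rw [show (((k+1 : ℕ) : ℝ) + (β + 1) + 1) = (((k+1 : ℕ) : ℝ) + β + 1 + 1) by ring, hk,
    show (m : ℝ) + (β + 2) + 1 = ((m + 1 : ℕ) : ℝ) + β + 1 + 1 by push_cast; ring, hm1,
    show (k : ℝ) + (β + 2) + 1 = ((k + 1 : ℕ) : ℝ) + β + 1 + 1 by push_cast; ring, hk,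
    show ((m : ℝ) + (β + 1) + 1) = ((m + 1 : ℕ) : ℝ) + β + 1 by push_cast; ring, hch2,
    Nat.factorial_succ]
  generalize Real.Gamma (((k + 1 : ℕ) : ℝ) + β + 1) = A at *
  generalize Real.Gamma (((m + 1 : ℕ) : ℝ) + β + 1) = B at *
  push_cast
  have hkb : (k : ℝ) + 1 + β + 1 ≠ 0 := by
    have : (0 : ℝ) ≤ k := Nat.cast_nonneg k
    linarith
  have hm1 : (m : ℝ) + 1 ≠ 0 := by positivity
  generalize (((m + 1).choose (k + 1) : ℕ) : ℝ) = c at *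
  have hc : (m.choose k : ℝ) = c * (k + 1) / (m + 1) := by field_simp; linarith
  rw [hc]
  have hA : A ≠ 0 := hkp.ne'
  field_simp
  ring

/-- connection formula -/
theorem lag_conn {α : ℝ} (hα : -1 < α) (x : ℝ) (j : ℕ) : ∀ m : ℕ,
    (((m + j).choose j : ℕ) : ℝ) * assocLaguerre α (m + j) x =
      ∑ k ∈ Finset.range (j + 1), (-x) ^ k *
        ((j.choose k : ℝ) * Real.Gamma ((j : ℝ) + α + 1) /
          (Real.Gamma ((k : ℝ) + α + 1) * j.factorial)) *
        assocLaguerre (α + j + k) m x := by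
  induction j with
  | zero =>
    intro m
    have := (gam_pos hα 0).ne'
    simp at this
    simp [this]
  | succ j ih =>
    intro m
    have h := ih (m + 1)
    have hj1 : (j : ℝ) + 1 ≠ 0 := by positivity
    have hch : (((m + (j + 1)).choose (j + 1) : ℕ) : ℝ) * (j + 1) =
        ((m + 1 + j).choose j : ℕ) * (m + 1) := by
      have := Nat.choose_succ_right_eq (m + 1 + j) j
      rw [show m + 1 + j - j = m + 1 by omega] at this
      rw [show m + (j + 1) = m + 1 + j by ring]
      exact_mod_cast this
    have h2 : ((j : ℝ) + 1) * ((((m + (j + 1)).choose (j + 1) : ℕ) : ℝ) *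
        assocLaguerre α (m + (j + 1)) x) = ∑ k ∈ Finset.range (j + 1), (-x) ^ k *
        ((j.choose k : ℝ) * Real.Gamma ((j : ℝ) + α + 1) /
          (Real.Gamma ((k : ℝ) + α + 1) * j.factorial)) *
        ((α + j + k + 1) * assocLaguerre (α + (j + 1 : ℕ) + k) m x
          - x * assocLaguerre (α + (j + 1 : ℕ) + (k + 1 : ℕ)) m x) := by
      rw [show m + (j + 1) = m + 1 + j by ring] at *
      rw [← mul_assoc, mul_comm ((j : ℝ) + 1), hch, mul_comm _ ((m : ℝ) + 1), mul_assoc, h,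
        Finset.mul_sum]
      refine Finset.sum_congr rfl fun k _ => ?_
      have := lag_rec (show -1 < α + j + k by
        have : (0 : ℝ) ≤ k := Nat.cast_nonneg k
        have : (0 : ℝ) ≤ j := Nat.cast_nonneg j
        linarith) m x
      rw [show α + ((j + 1 : ℕ) : ℝ) + k = α + j + k + 1 by push_cast; ring,
        show α + ((j + 1 : ℕ) : ℝ) + ((k + 1 : ℕ) : ℝ) = α + j + k + 2 by push_cast; ring, ← this]
      ring
    apply mul_left_cancel₀ hj1
    rw [h2]
    have split : ∀ k : ℕ, (-x) ^ k *
        ((j.choose k : ℝ) * Real.Gamma ((j : ℝ) + α + 1) /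
          (Real.Gamma ((k : ℝ) + α + 1) * j.factorial)) *
        ((α + j + k + 1) * assocLaguerre (α + (j + 1 : ℕ) + k) m x
          - x * assocLaguerre (α + (j + 1 : ℕ) + (k + 1 : ℕ)) m x) =
        (-x) ^ k * ((j.choose k : ℝ) * Real.Gamma ((j : ℝ) + α + 1) /
          (Real.Gamma ((k : ℝ) + α + 1) * j.factorial)) *
        ((α + j + k + 1) * assocLaguerre (α + (j + 1 : ℕ) + k) m x) +
        (-x) ^ (k + 1) * ((j.choose k : ℝ) * Real.Gamma ((j : ℝ) + α + 1) /
          (Real.Gamma ((k : ℝ) + α + 1) * j.factorial)) *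
        (assocLaguerre (α + (j + 1 : ℕ) + (k + 1 : ℕ)) m x) := by
      intro k; ring
    rw [Finset.sum_congr rfl fun k _ => split k, Finset.sum_add_distrib]
    have ext1 : ∑ k ∈ Finset.range (j + 1), (-x) ^ k *
          ((j.choose k : ℝ) * Real.Gamma ((j : ℝ) + α + 1) /
          (Real.Gamma ((k : ℝ) + α + 1) * j.factorial)) *
        ((α + j + k + 1) * assocLaguerre (α + (j + 1 : ℕ) + k) m x) =
        ∑ k ∈ Finset.range (j + 1 + 1), (-x) ^ k *
          ((j.choose k : ℝ) * Real.Gamma ((j : ℝ) + α + 1) /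
          (Real.Gamma ((k : ℝ) + α + 1) * j.factorial)) *
        ((α + j + k + 1) * assocLaguerre (α + (j + 1 : ℕ) + k) m x) := by
      rw [Finset.sum_range_succ _ (j + 1)]; simp
    rw [ext1, Finset.sum_range_succ' _ (j + 1), Finset.sum_range_succ' _ (j + 1), add_right_comm,
      ← Finset.sum_add_distrib, mul_add, Finset.mul_sum]
    have hjf : (j.factorial : ℝ) ≠ 0 := by positivity
    have hGj := gam_succ hα j
    rw [show (((j + 1 : ℕ) : ℝ) + α + 1) = (j : ℝ) + α + 1 + 1 by push_cast; ring, hGj,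
      Nat.factorial_succ]
    congr 1
    · refine Finset.sum_congr rfl fun k _ => ?_
      have hGk := gam_succ hα k
      have hGkp := (gam_pos hα k).ne'
      have hk0 : (0 : ℝ) ≤ k := Nat.cast_nonneg k
      rw [show (((k + 1 : ℕ) : ℝ) + α + 1) = (k : ℝ) + α + 1 + 1 by push_cast; ring, hGk]
      have hch : (((j + 1).choose (k + 1) : ℕ) : ℝ) * (k + 1) = (j + 1) * (j.choose k : ℝ) := by
        have := Nat.add_one_mul_choose_eq j k
        exact_mod_cast this.symm
      have hch2 : ((j.choose (k + 1) : ℕ) : ℝ) = ((j + 1).choose (k + 1) : ℕ) - (j.choose k : ℕ) := by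
        rw [Nat.choose_succ_succ' j k]; push_cast; ring
      rw [hch2]
      generalize assocLaguerre (α + (j + 1 : ℕ) + (k + 1 : ℕ)) m x = M
      generalize Real.Gamma ((k : ℝ) + α + 1) = A at *
      generalize Real.Gamma ((j : ℝ) + α + 1) = B at *
      generalize (((j + 1).choose (k + 1) : ℕ) : ℝ) = c at *
      have hc : (j.choose k : ℝ) = c * (k + 1) / (j + 1) := by field_simp; linarith
      rw [hc]
      push_cast
      have : (k : ℝ) + α + 1 ≠ 0 := by linarith
      field_simp
      ring
    · have hGp := (gam_pos hα 0).ne'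
      generalize Real.Gamma (((0 : ℕ) : ℝ) + α + 1) = A at *
      push_cast
      simp only [Nat.choose_zero_right]
      field_simp
      ring

theorem hasSum_cg {ι : Type*} {f g : ι → ℝ} {a : ℝ} (h : ∀ i, f i = g i) : HasSum f a ↔ HasSum g a := by
  rw [funext h]

/-- nonnegative iterated sums -/
theorem summable_iter {ι κ : Type*} {f : ι × κ → ℝ} {g : ι → ℝ} (h0 : ∀ i k, 0 ≤ f (i, k))
    (h1 : ∀ i, HasSum (fun k => f (i, k)) (g i)) (h2 : Summable g) : Summable f := by
  rw [summable_prod_of_nonneg (fun p => h0 p.1 p.2)]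
  refine ⟨fun k => (h1 k).summable, ?_⟩
  exact (summable_congr fun k => (h1 k).tsum_eq).mpr h2

/-- Fubini from absolute summability -/
theorem hasSum_iter {ι κ : Type*} {f : ι × κ → ℝ} {g : ι → ℝ} {a : ℝ} (h0 : Summable f)
    (h1 : ∀ i, HasSum (fun k => f (i, k)) (g i)) (h2 : HasSum g a) : HasSum f a := by
  have hs := h0.hasSum
  have hv := (hs.prod_fiberwise h1).unique h2
  rwa [hv] at hs

theorem gam_asc {a : ℝ} (ha : 0 < a) (n : ℕ) :
    (n.factorial : ℝ) * Ring.choose (a + n - 1) n = Real.Gamma (n + a) / Real.Gamma a := by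
  have h1 : Ring.choose (a + n - 1) n = Ring.multichoose a n := by
    unfold Ring.choose
    congr 1
    ring
  have h2 := Ring.factorial_nsmul_multichoose_eq_ascPochhammer a n
  rw [Polynomial.ascPochhammer_smeval_eq_eval, nsmul_eq_mul] at h2
  rw [h1, h2]
  have hG : Real.Gamma a ≠ 0 := (Real.Gamma_pos_of_pos ha).ne'
  clear h1 h2
  induction n with
  | zero => simp [hG]
  | succ n ih =>
    rw [ascPochhammer_succ_eval, ih]
    have : (n : ℝ) + a ≠ 0 := by positivity
    rw [show ((n + 1 : ℕ) : ℝ) + a = (n + a) + 1 by push_cast; ring, Real.Gamma_add_one this]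
    ring

theorem binom_hasSum {a : ℝ} (ha : 0 < a) {t : ℝ} (ht : |t| < 1) :
    HasSum (fun n : ℕ => Real.Gamma (n + a) / (Real.Gamma a * n.factorial) * t ^ n)
      ((1 - t) ^ (-a)) := by
  have h := (Real.one_div_one_sub_rpow_hasFPowerSeriesOnBall_zero a).hasSum (y := t)
    (by simpa [enorm_eq_nnnorm, ← NNReal.coe_lt_coe] using ht)
  have h1 : 0 < 1 - t := by linarith [(abs_lt.mp ht).2]
  rw [zero_add, one_div, ← Real.rpow_neg h1.le] at h
  refine (hasSum_cg fun n => ?_).mpr h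
  have := gam_asc ha n
  have hn : (n.factorial : ℝ) ≠ 0 := by positivity
  have e : Ring.choose (a + n - 1) n = Real.Gamma (n + a) / (Real.Gamma a * n.factorial) := by
    rw [← div_div, ← this]; field_simp
  simp [FormalMultilinearSeries.ofScalars, e, mul_comm]

theorem hasSum_antidiag {f : ℕ × ℕ → ℝ} {a : ℝ} (h : HasSum f a) :
    HasSum (fun n => ∑ p ∈ Finset.HasAntidiagonal.antidiagonal n, f p) a := by
  have h2 := (Finset.HasAntidiagonal.sigmaAntidiagonalEquivProd (A := ℕ)).hasSum_iff.mpr h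
  refine h2.sigma (fun n => ?_)
  have := hasSum_fintype (fun c : Finset.HasAntidiagonal.antidiagonal n => f c)
  rw [← Finset.sum_coe_sort]
  exact this

theorem lag_antidiag (β : ℝ) (n : ℕ) (x t : ℝ) :
    assocLaguerre β n x * t ^ n = ∑ p ∈ Finset.HasAntidiagonal.antidiagonal n,
      ((-x * t) ^ p.1 / p.1.factorial * (Real.Gamma (p.2 + (p.1 + β + 1)) /
        (Real.Gamma (p.1 + β + 1) * p.2.factorial) * t ^ p.2)) := by
  rw [Finset.Nat.sum_antidiagonal_eq_sum_range_succ_mk, assocLaguerre, Finset.sum_mul]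
  refine Finset.sum_congr rfl fun k hk => ?_
  have hk' : k ≤ n := by simpa [Nat.lt_succ_iff] using hk
  have : ((n - k : ℕ) : ℝ) + (k + β + 1) = n + β + 1 := by
    rw [Nat.cast_sub hk']; ring
  simp only [this]
  rw [mul_pow, neg_pow x]
  have e : t ^ n = t ^ k * t ^ (n - k) := by rw [← pow_add]; congr 1; omega
  rw [e]
  simp only [div_eq_mul_inv, mul_inv]
  ring

theorem lag_gen {β : ℝ} (hβ : -1 < β) (x : ℝ) {t : ℝ} (ht0 : 0 ≤ t) (ht : t < 1) :
    HasSum (fun n => assocLaguerre β n x * t ^ n)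
      ((1 - t) ^ (-β - 1) * Real.exp (-x * t / (1 - t))) := by
  have hab : |t| < 1 := by rwa [abs_of_nonneg ht0]
  have h1 : 0 < 1 - t := by linarith
  have key : ∀ z : ℝ, HasSum (fun k : ℕ => (z * t) ^ k / k.factorial * (1 - t) ^ (-((k : ℝ) + β + 1)))
      ((1 - t) ^ (-β - 1) * Real.exp (z * t / (1 - t))) := by
    intro z
    have h := (NormedSpace.expSeries_div_hasSum_exp (𝔸 := ℝ) (z * t / (1 - t)))
    rw [← Real.exp_eq_exp_ℝ] at h
    have h := h.mul_left ((1 - t) ^ (-β - 1))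
    refine (hasSum_cg fun k => ?_).mpr h
    rw [show -((k : ℝ) + β + 1) = (-β - 1) - k by ring, Real.rpow_sub h1, Real.rpow_natCast, div_pow]
    field_simp
  have inner : ∀ k : ℕ, HasSum (fun n : ℕ => Real.Gamma (n + (k + β + 1)) / (Real.Gamma (k + β + 1) * n.factorial) * t ^ n)
      ((1 - t) ^ (-((k : ℝ) + β + 1))) := fun k =>
    binom_hasSum (by have : (0 : ℝ) ≤ k := Nat.cast_nonneg k
                     linarith) hab
  have hsum : Summable (fun p : ℕ × ℕ => ((-x * t) ^ p.1 / p.1.factorial *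
      (Real.Gamma (p.2 + (p.1 + β + 1)) /
        (Real.Gamma (p.1 + β + 1) * p.2.factorial) * t ^ p.2))) := by
    apply Summable.of_norm
    have : Summable (fun p : ℕ × ℕ => ((|x| * t) ^ p.1 / p.1.factorial *
      (Real.Gamma (p.2 + (p.1 + β + 1)) /
        (Real.Gamma (p.1 + β + 1) * p.2.factorial) * t ^ p.2))) := by
      refine summable_iter ?_ (fun k => (inner k).mul_left ((|x| * t) ^ k / k.factorial))
        (key |x|).summable
      · intro p q
        have h1 := gam_pos hβ p
        have h2 : 0 < Real.Gamma (q + (p + β + 1)) := by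
          apply Real.Gamma_pos_of_pos
          have : (0 : ℝ) ≤ p := Nat.cast_nonneg _
          have : (0 : ℝ) ≤ q := Nat.cast_nonneg _
          linarith
        simp only
        positivity
    refine (summable_congr fun p => ?_).mpr this
    have h1 := gam_pos hβ p.1
    have h2 : 0 < Real.Gamma (p.2 + (p.1 + β + 1)) := by
      apply Real.Gamma_pos_of_pos
      have : (0 : ℝ) ≤ p.1 := Nat.cast_nonneg _
      have : (0 : ℝ) ≤ p.2 := Nat.cast_nonneg _
      linarith
    rw [Real.norm_eq_abs, abs_mul, abs_div, abs_pow, abs_mul, abs_neg, abs_of_nonneg ht0, Nat.abs_cast]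
    congr 1
    apply abs_of_nonneg
    positivity
  have hs := hasSum_iter hsum (fun k => (inner k).mul_left ((-x * t) ^ k / k.factorial)) (key (-x))
  have := hasSum_antidiag hs
  exact (hasSum_cg fun n => lag_antidiag β n x t).mpr this

/-- `F_α(u) = ∑ u^k / (k! Γ(k+α+1))`. -/
noncomputable def besF (α u : ℝ) : ℝ :=
  ∑' k : ℕ, u ^ k / (k.factorial * Real.Gamma ((k : ℝ) + α + 1))

theorem besF_summable {α : ℝ} (hα : -1 < α) (u : ℝ) :
    Summable (fun k : ℕ => u ^ k / (k.factorial * Real.Gamma ((k : ℝ) + α + 1))) := by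
  rw [← summable_nat_add_iff 1]
  have hmono : ∀ k : ℕ, Real.Gamma (((0 + 1 : ℕ) : ℝ) + α + 1) ≤
      Real.Gamma (((k + 1 : ℕ) : ℝ) + α + 1) := by
    intro k
    induction k with
    | zero => simp
    | succ k ih =>
      refine ih.trans ?_
      have h1 := gam_succ hα (k + 1)
      have h2 := gam_pos hα (k + 1)
      rw [show (((k + 1 + 1 : ℕ) : ℝ) + α + 1) = ((k + 1 : ℕ) : ℝ) + α + 1 + 1 by push_cast; ring, h1]
      have : (0 : ℝ) ≤ k := Nat.cast_nonneg _
      push_cast at *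
      nlinarith
  have h1 := ((summable_nat_add_iff 1).mpr (Real.summable_pow_div_factorial |u|)).div_const
    (Real.Gamma (((0 + 1 : ℕ) : ℝ) + α + 1))
  refine Summable.of_norm_bounded h1 fun k => ?_
  have hp := gam_pos hα (0 + 1)
  have hp2 := gam_pos hα (k + 1)
  rw [Real.norm_eq_abs, abs_div, abs_pow, abs_mul, Nat.abs_cast, abs_of_pos hp2, div_div]
  gcongr
  exact hmono k

theorem besF_hasSum {α : ℝ} (hα : -1 < α) (u : ℝ) :
    HasSum (fun k : ℕ => u ^ k / (k.factorial * Real.Gamma ((k : ℝ) + α + 1))) (besF α u) :=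
  (besF_summable hα u).hasSum

theorem lag_abs_le {β : ℝ} (hβ : -1 < β) (n : ℕ) (x : ℝ) :
    |assocLaguerre β n x| ≤ assocLaguerre β n (-|x|) := by
  rw [lag_choose, lag_choose]
  refine (Finset.abs_sum_le_sum_abs _ _).trans (Finset.sum_le_sum fun k _ => ?_)
  have h1 := gam_pos hβ k
  have h2 := gam_pos hβ n
  rw [abs_mul, abs_pow, abs_neg, neg_neg, abs_of_nonneg (by positivity)]

/-- The equivalence grouping the first two indices. -/
noncomputable def trip : (Σ q : ℕ × ℕ, Finset.HasAntidiagonal.antidiagonal q.1) ≃ (ℕ × ℕ) × ℕ where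
  toFun s := (s.2.1, s.1.2)
  invFun p := ⟨(p.1.1 + p.1.2, p.2), ⟨p.1, by simp⟩⟩
  left_inv := by
    rintro ⟨⟨j, m⟩, ⟨⟨k, l⟩, h⟩⟩
    rw [Finset.HasAntidiagonal.mem_antidiagonal] at h
    simp only at h
    subst h
    rfl
  right_inv := by
    rintro ⟨⟨k, l⟩, m⟩
    rfl

theorem hasSum_trip {f : (ℕ × ℕ) × ℕ → ℝ} {a : ℝ} (h : HasSum f a) :
    HasSum (fun q : ℕ × ℕ => ∑ p ∈ Finset.HasAntidiagonal.antidiagonal q.1, f (p, q.2)) a := by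
  have h2 := trip.hasSum_iff.mpr h
  refine h2.sigma (fun q => ?_)
  have := hasSum_fintype (fun c : Finset.HasAntidiagonal.antidiagonal q.1 => f (c, q.2))
  rw [← Finset.sum_coe_sort]
  exact this

theorem hasSum_mul_pair {f g : ℕ → ℝ} {a b : ℝ} (hf : HasSum f a) (hg : HasSum g b) :
    HasSum (fun p : ℕ × ℕ => f p.1 * g p.2) (a * b) :=
  hf.mul hg (summable_mul_of_summable_norm hf.summable.norm hg.summable.norm)

theorem hille_hardy {α : ℝ} (hα : -1 < α) (x y : ℝ) {t : ℝ} (ht0 : 0 ≤ t) (ht : t < 1) :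
    HasSum (fun n : ℕ => n.factorial / Real.Gamma ((n : ℝ) + α + 1) * assocLaguerre α n x *
        assocLaguerre α n y * t ^ n)
      ((1 - t) ^ (-α - 1) * Real.exp (-x * t / (1 - t)) *
        (besF α (x * y * t / (1 - t) ^ 2) * Real.exp (-y * t / (1 - t)))) := by
  have h1 : 0 < 1 - t := by linarith
  have hβ : ∀ k l : ℕ, -1 < α + 2 * k + l := by
    intro k l
    have : (0 : ℝ) ≤ k := Nat.cast_nonneg _
    have : (0 : ℝ) ≤ l := Nat.cast_nonneg _
    linarith
  -- sum over (k,l)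
  have hAB : ∀ u v : ℝ, HasSum (fun p : ℕ × ℕ =>
      u ^ p.1 / (p.1.factorial * Real.Gamma ((p.1 : ℝ) + α + 1)) * (v ^ p.2 / p.2.factorial))
      (besF α u * Real.exp v) := by
    intro u v
    have h := (NormedSpace.expSeries_div_hasSum_exp (𝔸 := ℝ) v)
    rw [← Real.exp_eq_exp_ℝ] at h
    exact hasSum_mul_pair (besF_hasSum hα u) h
  have hAB2 : ∀ (w y' x' : ℝ), HasSum (fun p : ℕ × ℕ =>
      (w * t) ^ p.1 / (p.1.factorial * Real.Gamma ((p.1 : ℝ) + α + 1)) *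
        ((y' * t) ^ p.2 / p.2.factorial) * ((1 - t) ^ (-(α + 2 * p.1 + p.2) - 1) *
          Real.exp (x' * t / (1 - t))))
      ((1 - t) ^ (-α - 1) * Real.exp (x' * t / (1 - t)) *
        (besF α (w * t / (1 - t) ^ 2) * Real.exp (y' * t / (1 - t)))) := by
    intro w y' x'
    have h := (hAB (w * t / (1 - t) ^ 2) (y' * t / (1 - t))).mul_left
      ((1 - t) ^ (-α - 1) * Real.exp (x' * t / (1 - t)))
    refine (hasSum_cg fun p => ?_).mpr h
    rw [show -(α + 2 * p.1 + p.2) - 1 = (-α - 1) - (2 * p.1 + p.2 : ℕ) by push_cast; ring,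
      Real.rpow_sub h1, Real.rpow_natCast, div_pow, div_pow, ← pow_mul, pow_add]
    have := (gam_pos hα p.1).ne'
    field_simp
  have inner : ∀ (w y' x' : ℝ) (p : ℕ × ℕ), HasSum (fun m : ℕ =>
      (w * t) ^ p.1 / (p.1.factorial * Real.Gamma ((p.1 : ℝ) + α + 1)) *
        ((y' * t) ^ p.2 / p.2.factorial) * (assocLaguerre (α + 2 * p.1 + p.2) m (-x') * t ^ m))
      ((w * t) ^ p.1 / (p.1.factorial * Real.Gamma ((p.1 : ℝ) + α + 1)) *
        ((y' * t) ^ p.2 / p.2.factorial) * ((1 - t) ^ (-(α + 2 * p.1 + p.2) - 1) *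
          Real.exp (x' * t / (1 - t)))) := by
    intro w y' x' p
    have := lag_gen (hβ p.1 p.2) (-x') ht0 ht
    rw [neg_neg] at this
    exact this.mul_left _
  have hsum : Summable (fun q : (ℕ × ℕ) × ℕ =>
      (x * y * t) ^ q.1.1 / (q.1.1.factorial * Real.Gamma ((q.1.1 : ℝ) + α + 1)) *
        ((-y * t) ^ q.1.2 / q.1.2.factorial) *
        (assocLaguerre (α + 2 * q.1.1 + q.1.2) q.2 (- -x) * t ^ q.2)) := by
    have hmaj : Summable (fun q : (ℕ × ℕ) × ℕ =>
      (|x| * |y| * t) ^ q.1.1 / (q.1.1.factorial * Real.Gamma ((q.1.1 : ℝ) + α + 1)) *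
        ((|y| * t) ^ q.1.2 / q.1.2.factorial) *
        (assocLaguerre (α + 2 * q.1.1 + q.1.2) q.2 (- |x|) * t ^ q.2)) := by
      refine summable_iter ?_ (inner (|x| * |y|) |y| |x|) (hAB2 _ _ _).summable
      rintro p m
      have h1 := gam_pos hα p.1
      have h2 := (abs_nonneg _).trans (lag_abs_le (hβ p.1 p.2) m x)
      simp only
      positivity
    refine Summable.of_norm_bounded hmaj fun q => ?_
    have h1 := gam_pos hα q.1.1
    have h2 := lag_abs_le (hβ q.1.1 q.1.2) q.2 x
    rw [Real.norm_eq_abs, neg_neg]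
    simp only [abs_mul, abs_div, abs_pow, abs_neg, Nat.abs_cast, abs_of_nonneg ht0, abs_of_pos h1]
    gcongr
  have htot := hasSum_iter hsum (inner (x * y) (-y) (-x)) (hAB2 (x * y) (-y) (-x))
  have h3 := hasSum_antidiag (hasSum_trip htot)
  refine (hasSum_cg fun n => ?_).mpr h3
  have step : ∀ j m : ℕ, ∑ p ∈ Finset.HasAntidiagonal.antidiagonal j,
      ((x * y * t) ^ p.1 / (p.1.factorial * Real.Gamma ((p.1 : ℝ) + α + 1)) *
        ((-y * t) ^ p.2 / p.2.factorial) *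
        (assocLaguerre (α + 2 * p.1 + p.2) m (- -x) * t ^ m)) =
      t ^ (m + j) * (-y) ^ j / Real.Gamma ((j : ℝ) + α + 1) * ((((m + j).choose j : ℕ) : ℝ) *
        assocLaguerre α (m + j) x) := by
    intro j m
    rw [lag_conn hα x j m, Finset.Nat.sum_antidiagonal_eq_sum_range_succ_mk, Finset.mul_sum]
    refine Finset.sum_congr rfl fun k hk => ?_
    have hk' : k ≤ j := by simpa [Nat.lt_succ_iff] using hk
    obtain ⟨l, rfl⟩ := Nat.exists_eq_add_of_le hk'
    simp only [Nat.add_sub_cancel_left]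
    rw [Nat.cast_choose ℝ hk', Nat.add_sub_cancel_left, neg_neg,
      show α + ((k + l : ℕ) : ℝ) + k = α + 2 * k + l by push_cast; ring]
    have g1 := (gam_pos hα k).ne'
    have g2 := (gam_pos hα (k + l)).ne'
    have f1 : (k.factorial : ℝ) ≠ 0 := by positivity
    have f2 : (l.factorial : ℝ) ≠ 0 := by positivity
    have f3 : ((k + l).factorial : ℝ) ≠ 0 := by positivity
    rw [neg_pow x, neg_mul, neg_pow (y * t), neg_pow y, pow_add (-1 : ℝ) k l]
    have sq : ((-1 : ℝ) ^ k) * (-1) ^ k = 1 := by rw [← mul_pow]; simp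
    field_simp
    rw [pow_two, sq]
    ring
  simp only [step]
  rw [lag_choose α n y, mul_assoc, mul_assoc, Finset.sum_mul, Finset.mul_sum, Finset.mul_sum,
    Finset.Nat.sum_antidiagonal_eq_sum_range_succ_mk]
  refine Finset.sum_congr rfl fun j hj => ?_
  have hj' : j ≤ n := by simpa [Nat.lt_succ_iff] using hj
  rw [Nat.sub_add_cancel hj']
  have g1 := (gam_pos hα j).ne'
  have g2 := (gam_pos hα n).ne'
  have f1 : (n.factorial : ℝ) ≠ 0 := by positivity
  field_simp

/-- Normalised Bessel asymptotics at order `α`. -/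
def BesA (α : ℝ) : Prop :=
  Tendsto (fun z : ℝ => z ^ (α + 1 / 2) * besF α (z ^ 2) * Real.exp (-(2 * z))) atTop
    (𝓝 (1 / (2 * √Real.pi)))

theorem besF_half_neg (z : ℝ) : besF (-1 / 2) (z ^ 2) = Real.cosh (2 * z) / √Real.pi := by
  refine ((hasSum_cg fun k => ?_).mpr ((Real.hasSum_cosh (2 * z)).div_const (√Real.pi))).tsum_eq
  have h := Real.Gamma_mul_Gamma_add_half ((k : ℝ) + 1 / 2)
  rw [show (k : ℝ) + 1 / 2 + 1 / 2 = k + 1 by ring, show 2 * ((k : ℝ) + 1 / 2) = ((2 * k : ℕ) : ℝ) + 1 by push_cast; ring,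
    Real.Gamma_nat_eq_factorial, Real.Gamma_nat_eq_factorial,
    show (1 : ℝ) - (((2 * k : ℕ) : ℝ) + 1) = -((2 * k : ℕ) : ℝ) by ring, Real.rpow_neg (by norm_num),
    Real.rpow_natCast] at h
  rw [show (k : ℝ) + -1 / 2 + 1 = k + 1 / 2 by ring, mul_comm, h]
  have : √Real.pi ≠ 0 := by positivity
  rw [mul_pow, ← pow_mul]
  field_simp

theorem besF_half {z : ℝ} (hz : 0 < z) : besF (1 / 2) (z ^ 2) = Real.sinh (2 * z) / √Real.pi / z := by
  refine ((hasSum_cg fun k => ?_).mpr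
    (((Real.hasSum_sinh (2 * z)).div_const (√Real.pi)).div_const z)).tsum_eq
  have h := Real.Gamma_mul_Gamma_add_half ((k : ℝ) + 1)
  rw [show (k : ℝ) + 1 + 1 / 2 = k + 1 / 2 + 1 by ring, show 2 * ((k : ℝ) + 1) = ((2 * k + 1 : ℕ) : ℝ) + 1 by push_cast; ring,
    Real.Gamma_nat_eq_factorial, Real.Gamma_nat_eq_factorial,
    show (1 : ℝ) - (((2 * k + 1 : ℕ) : ℝ) + 1) = -((2 * k + 1: ℕ) : ℝ) by ring, Real.rpow_neg (by norm_num),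
    Real.rpow_natCast] at h
  rw [h]
  have : √Real.pi ≠ 0 := by positivity
  rw [mul_pow, ← pow_mul]
  field_simp
  ring

theorem exp4 : Tendsto (fun z : ℝ => Real.exp (-(4 * z))) atTop (𝓝 0) :=
  Real.tendsto_exp_neg_atTop_nhds_zero.comp (tendsto_id.const_mul_atTop (by norm_num : (0 : ℝ) < 4))

theorem besA_half_neg : BesA (-1 / 2) := by
  have h : Tendsto (fun z : ℝ => (1 + Real.exp (-(4 * z))) / (2 * √Real.pi)) atTop
      (𝓝 ((1 + 0) / (2 * √Real.pi))) := (exp4.const_add 1).div_const _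
  rw [add_zero] at h
  refine h.congr fun z => ?_
  rw [besF_half_neg, show (-1 / 2 + 1 / 2 : ℝ) = 0 by ring, Real.rpow_zero, Real.cosh_eq,
    show -(4 * z) = -(2 * z) + -(2 * z) by ring, Real.exp_add]
  have : Real.exp (2 * z) * Real.exp (-(2 * z)) = 1 := by rw [← Real.exp_add]; simp
  field_simp
  linear_combination -this

theorem besA_half : BesA (1 / 2) := by
  have h : Tendsto (fun z : ℝ => (1 - Real.exp (-(4 * z))) / (2 * √Real.pi)) atTop
      (𝓝 ((1 - 0) / (2 * √Real.pi))) := (exp4.const_sub 1).div_const _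
  rw [sub_zero] at h
  refine h.congr' ?_
  filter_upwards [eventually_gt_atTop 0] with z hz
  rw [besF_half hz, show (1 / 2 + 1 / 2 : ℝ) = 1 by ring, Real.rpow_one, Real.sinh_eq,
    show -(4 * z) = -(2 * z) + -(2 * z) by ring, Real.exp_add]
  have : Real.exp (2 * z) * Real.exp (-(2 * z)) = 1 := by rw [← Real.exp_add]; simp
  field_simp
  linear_combination -this

/-- `∑ k u^k/(k! Γ(k+α+1)) = u F_{α+1}(u)`. -/
theorem besF_moment {α : ℝ} (hα : -1 < α) (u : ℝ) :
    HasSum (fun k : ℕ => k * (u ^ k / (k.factorial * Real.Gamma ((k : ℝ) + α + 1))))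
      (u * besF (α + 1) u) := by
  rw [← hasSum_nat_add_iff' 1]
  simp only [Finset.range_one, Finset.sum_singleton, CharP.cast_eq_zero, zero_mul, sub_zero]
  refine (hasSum_cg fun k => ?_).mpr ((besF_hasSum (show -1 < α + 1 by linarith) u).mul_left u)
  rw [show (((k + 1 : ℕ) : ℝ) + α + 1) = k + (α + 1) + 1 by push_cast; ring, Nat.factorial_succ]
  have := (gam_pos (show -1 < α + 1 by linarith) k).ne'
  push_cast
  field_simp
  ring

theorem besF_moment' {α : ℝ} (hα : -1 < α) (u c : ℝ) :
    HasSum (fun k : ℕ => (k + c) * (u ^ k / (k.factorial * Real.Gamma ((k : ℝ) + α + 1))))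
      (u * besF (α + 1) u + c * besF α u) := by
  refine (hasSum_cg fun k => ?_).mpr ((besF_moment hα u).add ((besF_hasSum hα u).mul_left c))
  ring

theorem besF_rec {α : ℝ} (hα : -1 < α) (u : ℝ) :
    besF α u = u * besF (α + 2) u + (α + 1) * besF (α + 1) u := by
  have h := besF_moment' (show -1 < α + 1 by linarith) u (α + 1)
  rw [show α + 1 + 1 = α + 2 by ring] at h
  refine HasSum.tsum_eq ((hasSum_cg fun k => ?_).mpr h)
  rw [show (k : ℝ) + (α + 1) + 1 = k + α + 1 + 1 by ring, gam_succ hα k]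
  have := (gam_pos hα k).ne'
  have h0 : (0 : ℝ) ≤ k := Nat.cast_nonneg _
  have : (k : ℝ) + α + 1 ≠ 0 := by linarith
  rw [← add_assoc]
  field_simp

theorem besA_rec_eq {α : ℝ} (hα : -1 < α) {z : ℝ} (hz : 0 < z) :
    z ^ (α + 1 / 2) * besF α (z ^ 2) * Real.exp (-(2 * z)) =
      z ^ (α + 2 + 1 / 2) * besF (α + 2) (z ^ 2) * Real.exp (-(2 * z)) +
      (α + 1) * z⁻¹ * (z ^ (α + 1 + 1 / 2) * besF (α + 1) (z ^ 2) * Real.exp (-(2 * z))) := by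
  rw [besF_rec hα, show α + 2 + 1 / 2 = (α + 1 / 2) + (2 : ℕ) by push_cast; ring,
    show α + 1 + 1 / 2 = (α + 1 / 2) + 1 by ring, Real.rpow_add_natCast hz.ne',
    Real.rpow_add_one hz.ne']
  field_simp

theorem besA_down {α : ℝ} (hα : -1 < α) (h1 : BesA (α + 1)) (h2 : BesA (α + 2)) : BesA α := by
  have h := h2.add ((tendsto_inv_atTop_zero.const_mul (α + 1)).mul h1)
  rw [mul_zero, zero_mul, add_zero] at h
  refine h.congr' ?_
  filter_upwards [eventually_gt_atTop 0] with z hz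
  rw [besA_rec_eq hα hz]

theorem besA_up {α : ℝ} (hα : -1 < α) (h1 : BesA α) (h2 : BesA (α + 1)) : BesA (α + 2) := by
  have h := h1.sub ((tendsto_inv_atTop_zero.const_mul (α + 1)).mul h2)
  rw [mul_zero, zero_mul, sub_zero] at h
  refine h.congr' ?_
  filter_upwards [eventually_gt_atTop 0] with z hz
  rw [besA_rec_eq hα hz]
  ring

theorem besA_nat (m : ℕ) : BesA (-1 / 2 + m) ∧ BesA (-1 / 2 + m + 1) := by
  induction m with
  | zero =>
    refine ⟨by simpa using besA_half_neg, ?_⟩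
    have := besA_half
    convert this using 1
    norm_num
  | succ m ih =>
    have e : -1 / 2 + ((m + 1 : ℕ) : ℝ) = -1 / 2 + m + 1 := by push_cast; ring
    rw [e]
    refine ⟨ih.2, ?_⟩
    have h0 : (0 : ℝ) ≤ m := Nat.cast_nonneg _
    have := besA_up (by linarith) ih.1 ih.2
    rwa [show -1 / 2 + (m : ℝ) + 1 + 1 = -1 / 2 + m + 2 by ring]

theorem gam_conv {X θ : ℝ} (hX : 0 < X) (h0 : 0 < θ) (h1 : θ < 1) :
    Real.Gamma (X + θ) ≤ X ^ θ * Real.Gamma X := by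
  have h := Real.Gamma_mul_add_mul_le_rpow_Gamma_mul_rpow_Gamma hX (show 0 < X + 1 by linarith)
    (show 0 < 1 - θ by linarith) h0 (by ring)
  rw [show (1 - θ) * X + θ * (X + 1) = X + θ by ring, Real.Gamma_add_one hX.ne'] at h
  have hG := Real.Gamma_pos_of_pos hX
  refine h.trans_eq ?_
  rw [Real.mul_rpow hX.le hG.le, mul_left_comm, ← Real.rpow_add hG]
  simp

theorem rpow_tangent {X z θ : ℝ} (hX : 0 < X) (hz : 0 < z) (h0 : 0 < θ) (h1 : θ < 1) :
    X ^ θ ≤ z ^ θ * (1 - θ + θ * (X / z)) := by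
  have h := Real.geom_mean_le_arith_mean2_weighted (show 0 ≤ 1 - θ by linarith) h0.le
    (zero_le_one) (div_pos hX hz).le (by ring)
  rw [Real.one_rpow, one_mul, mul_one, Real.div_rpow hX.le hz.le] at h
  have hz' : 0 < z ^ θ := Real.rpow_pos_of_pos hz _
  rw [div_le_iff₀ hz'] at h
  linarith

theorem rpow_tangent' {X z θ : ℝ} (hX : 0 < X) (hz : 0 < z) (h0 : 0 < θ) (h1 : θ < 1) :
    z ^ (-θ) * (1 + θ - θ * (X / z)) ≤ (X ^ θ)⁻¹ := by
  have h := rpow_tangent hX hz h0 h1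
  have hz' : 0 < z ^ θ := Real.rpow_pos_of_pos hz _
  have hX' : 0 < X ^ θ := Real.rpow_pos_of_pos hX _
  rw [Real.rpow_neg hz.le]
  have hv : 0 < X / z := div_pos hX hz
  generalize X / z = v at *
  have hp : 0 < 1 - θ + θ * v := by nlinarith
  have h3 : (1 + θ - θ * v) ≤ (1 - θ + θ * v)⁻¹ := by
    rw [inv_eq_one_div, le_div_iff₀ hp]
    nlinarith [sq_nonneg (θ * (v - 1))]
  calc (z ^ θ)⁻¹ * (1 + θ - θ * v) ≤ (z ^ θ)⁻¹ * (1 - θ + θ * v)⁻¹ := by gcongr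
    _ = (z ^ θ * (1 - θ + θ * v))⁻¹ := by rw [mul_inv]
    _ ≤ _ := by gcongr

theorem besF_lower {β θ z : ℝ} (hβ : -1 < β) (h0 : 0 < θ) (h1 : θ < 1) (hz : 0 < z) :
    z ^ (-θ) * ((1 + θ - θ * (β + 1) / z) * besF β (z ^ 2) - θ * z * besF (β + 1) (z ^ 2)) ≤
      besF (β + θ) (z ^ 2) := by
  have hs := (((besF_hasSum hβ (z ^ 2)).mul_left (1 + θ)).sub
    ((besF_moment' hβ (z ^ 2) (β + 1)).mul_left (θ / z))).mul_left (z ^ (-θ))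
  have hle := hasSum_le (fun k => ?_) hs (besF_hasSum (show -1 < β + θ by linarith) (z ^ 2))
  · refine le_trans (le_of_eq ?_) hle
    field_simp
    ring
  · have hk : (0 : ℝ) ≤ k := Nat.cast_nonneg _
    have hX : 0 < (k : ℝ) + β + 1 := by linarith
    have hG := gam_pos hβ k
    have hG2 := gam_pos (show -1 < β + θ by linarith) k
    have hc := gam_conv hX h0 h1
    rw [show (k : ℝ) + β + 1 + θ = k + (β + θ) + 1 by ring] at hc
    have ht := rpow_tangent' hX hz h0 h1
    have hX' : 0 < ((k : ℝ) + β + 1) ^ θ := Real.rpow_pos_of_pos hX _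
    calc _ = (z ^ 2) ^ k / (k.factorial * Real.Gamma ((k : ℝ) + β + 1)) *
          (z ^ (-θ) * (1 + θ - θ * (((k : ℝ) + β + 1) / z))) := by ring
      _ ≤ (z ^ 2) ^ k / (k.factorial * Real.Gamma ((k : ℝ) + β + 1)) *
          (((k : ℝ) + β + 1) ^ θ)⁻¹ := by gcongr
      _ = (z ^ 2) ^ k / (k.factorial * (((k : ℝ) + β + 1) ^ θ * Real.Gamma ((k : ℝ) + β + 1))) := by
        field_simp
      _ ≤ _ := by gcongr

theorem besF_upper {β θ z : ℝ} (hβ : -1 < β) (h0 : 0 < θ) (h1 : θ < 1) (hz : 0 < z) :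
    besF (β + θ) (z ^ 2) ≤
    z ^ (1 - θ) * ((θ + (1 - θ) * (β + θ + 1) / z) * besF (β + 1) (z ^ 2) +
      (1 - θ) * z * besF (β + 2) (z ^ 2)) := by
  have hs := (((besF_hasSum (show -1 < β + 1 by linarith) (z ^ 2)).mul_left θ).add
    ((besF_moment' (show -1 < β + 1 by linarith) (z ^ 2) (β + θ + 1)).mul_left
      ((1 - θ) / z))).mul_left (z ^ (1 - θ))
  have hle := hasSum_le (fun k => ?_) (besF_hasSum (show -1 < β + θ by linarith) (z ^ 2)) hs
  · refine le_trans hle (le_of_eq ?_)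
    rw [show β + 1 + 1 = β + 2 by ring]
    field_simp
    ring
  · have hk : (0 : ℝ) ≤ k := Nat.cast_nonneg _
    have hX : 0 < (k : ℝ) + (β + θ) + 1 := by linarith
    have hG := gam_pos (show -1 < β + 1 by linarith) k
    have hG2 := gam_pos (show -1 < β + θ by linarith) k
    have hc := gam_conv hX (show 0 < 1 - θ by linarith) (by linarith)
    rw [show (k : ℝ) + (β + θ) + 1 + (1 - θ) = k + (β + 1) + 1 by ring] at hc
    have ht := rpow_tangent hX hz (show 0 < 1 - θ by linarith) (by linarith)
    have hX' : 0 < ((k : ℝ) + (β + θ) + 1) ^ (1 - θ) := Real.rpow_pos_of_pos hX _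
    calc _ = (z ^ 2) ^ k / k.factorial * (1 / Real.Gamma ((k : ℝ) + (β + θ) + 1)) := by
          field_simp
      _ ≤ (z ^ 2) ^ k / k.factorial * (((k : ℝ) + (β + θ) + 1) ^ (1 - θ) /
            Real.Gamma ((k : ℝ) + (β + 1) + 1)) := by
          gcongr ?_ * ?_
          rw [div_le_div_iff₀ hG2 hG]
          linarith
      _ ≤ (z ^ 2) ^ k / k.factorial * ((z ^ (1 - θ) * (1 - (1 - θ) + (1 - θ) * (((k : ℝ) + (β + θ) + 1) / z))) /
            Real.Gamma ((k : ℝ) + (β + 1) + 1)) := by gcongr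
      _ = _ := by
          field_simp
          ring

theorem besA_interp {β θ : ℝ} (hβ : -1 < β) (h0 : 0 < θ) (h1 : θ < 1) (hA : BesA β)
    (hB : BesA (β + 1)) (hC : BesA (β + 2)) : BesA (β + θ) := by
  have inv0 : ∀ c : ℝ, Tendsto (fun z : ℝ => c / z) atTop (𝓝 0) := fun c => by
    simpa [div_eq_mul_inv] using (tendsto_inv_atTop_zero (𝕜 := ℝ)).const_mul c
  have hl := (((inv0 (θ * (β + 1))).const_sub (1 + θ)).mul hA).sub (hB.const_mul θ)
  have hu := (((inv0 ((1 - θ) * (β + θ + 1))).const_add θ).mul hB).add (hC.const_mul (1 - θ))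
  rw [show (1 + θ - 0) * (1 / (2 * √Real.pi)) - θ * (1 / (2 * √Real.pi)) = 1 / (2 * √Real.pi) by ring] at hl
  rw [show (θ + 0) * (1 / (2 * √Real.pi)) + (1 - θ) * (1 / (2 * √Real.pi)) = 1 / (2 * √Real.pi) by ring] at hu
  refine tendsto_of_tendsto_of_tendsto_of_le_of_le' hl hu ?_ ?_
  · filter_upwards [eventually_gt_atTop 0] with z hz
    have h := besF_lower hβ h0 h1 hz
    have hp : 0 < z ^ (β + θ + 1 / 2) * Real.exp (-(2 * z)) := by positivity
    have h2 := mul_le_mul_of_nonneg_left h hp.le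
    have e1 : z ^ (β + θ + 1 / 2) * z ^ (-θ) = z ^ (β + 1 / 2) := by
      rw [← Real.rpow_add hz]; congr 1; ring
    have e2 : z ^ (β + 1 + 1 / 2) = z ^ (β + 1 / 2) * z := by
      rw [← Real.rpow_add_one hz.ne']; congr 1; ring
    rw [e2, ← e1]
    refine le_trans (le_of_eq ?_) (h2.trans (le_of_eq ?_))
    · ring
    · ring
  · filter_upwards [eventually_gt_atTop 0] with z hz
    have h := besF_upper hβ h0 h1 hz
    have hp : 0 < z ^ (β + θ + 1 / 2) * Real.exp (-(2 * z)) := by positivity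
    have h2 := mul_le_mul_of_nonneg_left h hp.le
    have e1 : z ^ (β + θ + 1 / 2) * z ^ (1 - θ) = z ^ (β + 1 + 1 / 2) := by
      rw [← Real.rpow_add hz]; congr 1; ring
    have e2 : z ^ (β + 2 + 1 / 2) = z ^ (β + 1 + 1 / 2) * z := by
      rw [← Real.rpow_add_one hz.ne']; congr 1; ring
    rw [e2, ← e1]
    refine le_trans (le_of_eq ?_) (h2.trans (le_of_eq ?_))
    · ring
    · ring

theorem besA_ge {α : ℝ} (hα : -1 / 2 ≤ α) : BesA α := by
  set m := ⌊α + 1 / 2⌋₊ with hm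
  have h1 : (m : ℝ) ≤ α + 1 / 2 := Nat.floor_le (by linarith)
  have h2 : α + 1 / 2 < m + 1 := Nat.lt_floor_add_one _
  have h0 : (0 : ℝ) ≤ m := Nat.cast_nonneg _
  have hA := besA_nat m
  have hB := besA_nat (m + 1)
  rcases h1.eq_or_lt with h | h
  · have := hA.1
    rwa [show -1 / 2 + (m : ℝ) = α by linarith] at this
  · have := besA_interp (β := -1 / 2 + m) (θ := α + 1 / 2 - m) (by linarith) (by linarith)
      (by linarith) hA.1 hA.2 (by
        have := hB.2
        push_cast at this
        rwa [show -1 / 2 + (m : ℝ) + 2 = -1 / 2 + (m + 1) + 1 by ring])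
    rwa [show -1 / 2 + (m : ℝ) + (α + 1 / 2 - m) = α by ring] at this

theorem besA_all {α : ℝ} (hα : -1 < α) : BesA α :=
  besA_down hα (besA_ge (by linarith)) (besA_ge (by linarith))

/-- closed form of the generating function. -/
noncomputable def hhVal (α x y t : ℝ) : ℝ :=
  (1 - t) ^ (-α - 1) * Real.exp (-x * t / (1 - t)) *
        (besF α (x * y * t / (1 - t) ^ 2) * Real.exp (-y * t / (1 - t)))

theorem hhVal_eq {α x y t : ℝ} (hx : 0 < x) (hy : 0 < y) (ht0 : 0 < t) (ht : t < 1) :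
    √(1 - t) * hhVal α x y t =
      ((√(x * y * t) / (1 - t)) ^ (α + 1 / 2) * besF α ((√(x * y * t) / (1 - t)) ^ 2) *
        Real.exp (-(2 * (√(x * y * t) / (1 - t))))) * √(x * y * t) ^ (-α - 1 / 2) *
        Real.exp ((2 * √(x * y * t) - (x + y) * t) / (1 - t)) := by
  have h1 : 0 < 1 - t := by linarith
  have hp : 0 < x * y * t := by positivity
  have hq : 0 < √(x * y * t) := Real.sqrt_pos.mpr hp
  rw [div_pow, Real.sq_sqrt hp.le, hhVal, Real.sqrt_eq_rpow, Real.div_rpow hq.le h1.le]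
  generalize besF α (x * y * t / (1 - t) ^ 2) = B
  rw [show -α - 1 / 2 = -(α + 1 / 2) by ring, Real.rpow_neg hq.le]
  have e1 : (1 - t) ^ (1 / 2 : ℝ) * (1 - t) ^ (-α - 1) = ((1 - t) ^ (α + 1 / 2))⁻¹ := by
    rw [← Real.rpow_add h1, ← Real.rpow_neg h1.le]; congr 1; ring
  have e2 : Real.exp (-x * t / (1 - t)) * Real.exp (-y * t / (1 - t)) =
      Real.exp (-(2 * (√(x * y * t) / (1 - t)))) *
      Real.exp ((2 * √(x * y * t) - (x + y) * t) / (1 - t)) := by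
    rw [← Real.exp_add, ← Real.exp_add]; congr 1; field_simp; ring
  have hq' : 0 < √(x * y * t) ^ (α + 1 / 2) := Real.rpow_pos_of_pos hq _
  calc _ = ((1 - t) ^ (1 / 2 : ℝ) * (1 - t) ^ (-α - 1)) * B *
        (Real.exp (-x * t / (1 - t)) * Real.exp (-y * t / (1 - t))) := by ring
    _ = _ := by
      rw [e1, e2]
      field_simp

theorem tendsto_one_sub : Tendsto (fun t : ℝ => 1 - t) (𝓝[<] 1) (𝓝[>] 0) := by
  refine tendsto_nhdsWithin_iff.mpr ⟨?_, ?_⟩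
  · have : Tendsto (fun t : ℝ => 1 - t) (𝓝 1) (𝓝 (1 - 1)) := by
      exact (continuous_const.sub continuous_id).tendsto 1
    rw [sub_self] at this
    exact this.mono_left nhdsWithin_le_nhds
  · filter_upwards [self_mem_nhdsWithin] with t ht
    simpa using ht

theorem hh_common {α : ℝ} (hα : -1 < α) {x y : ℝ} (hx : 0 < x) (hy : 0 < y) :
    Tendsto (fun t => ((√(x * y * t) / (1 - t)) ^ (α + 1 / 2) *
        besF α ((√(x * y * t) / (1 - t)) ^ 2) *
        Real.exp (-(2 * (√(x * y * t) / (1 - t))))) * √(x * y * t) ^ (-α - 1 / 2)) (𝓝[<] 1)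
      (𝓝 (1 / (2 * √Real.pi) * √(x * y) ^ (-α - 1 / 2))) := by
  have hp : 0 < x * y := by positivity
  have hq : 0 < √(x * y) := Real.sqrt_pos.mpr hp
  have hs : Tendsto (fun t : ℝ => √(x * y * t)) (𝓝[<] 1) (𝓝 (√(x * y))) := by
    have : Tendsto (fun t : ℝ => √(x * y * t)) (𝓝 1) (𝓝 (√(x * y * 1))) :=
      (Real.continuous_sqrt.comp (continuous_const.mul continuous_id)).tendsto 1
    rw [mul_one] at this
    exact this.mono_left nhdsWithin_le_nhds
  have hz : Tendsto (fun t : ℝ => √(x * y * t) / (1 - t)) (𝓝[<] 1) atTop := by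
    simp only [div_eq_mul_inv]
    exact hs.pos_mul_atTop hq (tendsto_inv_nhdsGT_zero.comp tendsto_one_sub)
  exact ((besA_all hα).comp hz).mul (hs.rpow_const (Or.inl hq.ne'))

theorem hh_diag_t {α : ℝ} (hα : -1 < α) {x : ℝ} (hx : 0 < x) :
    Tendsto (fun t => √(1 - t) * hhVal α x x t) (𝓝[<] 1)
      (𝓝 (1 / (2 * √Real.pi) * x ^ (-α - 1 / 2) * Real.exp x)) := by
  have h := hh_common hα hx hx
  rw [Real.sqrt_mul_self hx.le] at h
  have hE : Tendsto (fun t : ℝ => Real.exp (2 * x * √t / (1 + √t))) (𝓝[<] 1) (𝓝 (Real.exp x)) := by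
    have : ContinuousAt (fun t : ℝ => Real.exp (2 * x * √t / (1 + √t))) 1 := by
      have h0 : 1 + √(1 : ℝ) ≠ 0 := by simp
      fun_prop (disch := assumption)
    have := this.tendsto
    rw [Real.sqrt_one, show 2 * x * 1 / (1 + 1) = x by ring] at this
    exact this.mono_left nhdsWithin_le_nhds
  refine (h.mul hE).congr' ?_
  filter_upwards [Ioo_mem_nhdsLT (show (0 : ℝ) < 1 by norm_num)] with t ht
  rw [hhVal_eq hx hx ht.1 ht.2]
  congr 2
  have hst : √(x * x * t) = x * √t := by
    rw [Real.sqrt_mul (by positivity), Real.sqrt_mul_self hx.le]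
  rw [hst]
  have h0 : 0 < √t := Real.sqrt_pos.mpr ht.1
  have h1 : √t < 1 := by rw [Real.sqrt_lt' one_pos]; simpa using ht.2
  have h2 : t = √t ^ 2 := (Real.sq_sqrt ht.1.le).symm
  generalize √t = r at *
  subst h2
  have : 1 - r ^ 2 ≠ 0 := by nlinarith
  field_simp
  ring

theorem hh_off_t {α : ℝ} (hα : -1 < α) {x y : ℝ} (hx : 0 < x) (hy : 0 < y) (hxy : x ≠ y) :
    Tendsto (fun t => √(1 - t) * hhVal α x y t) (𝓝[<] 1) (𝓝 0) := by
  have h := hh_common hα hx hy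
  have hE : Tendsto (fun t : ℝ => Real.exp ((2 * √(x * y * t) - (x + y) * t) / (1 - t))) (𝓝[<] 1)
      (𝓝 0) := by
    refine Real.tendsto_exp_atBot.comp ?_
    have hc : Tendsto (fun t : ℝ => 2 * √(x * y * t) - (x + y) * t) (𝓝[<] 1)
        (𝓝 (2 * √(x * y) - (x + y))) := by
      have : Continuous (fun t : ℝ => 2 * √(x * y * t) - (x + y) * t) := by fun_prop
      have := this.tendsto 1
      rw [mul_one, mul_one] at this
      exact this.mono_left nhdsWithin_le_nhds
    have hneg : 2 * √(x * y) - (x + y) < 0 := by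
      rw [Real.sqrt_mul hx.le]
      have h1 := Real.sq_sqrt hx.le
      have h2 := Real.sq_sqrt hy.le
      have hne : √x - √y ≠ 0 := by
        intro h
        apply hxy
        rw [← h1, ← h2, sub_eq_zero.mp h]
      have := pow_pos (abs_pos.mpr hne) 2
      rw [sq_abs] at this
      nlinarith
    simp only [div_eq_mul_inv]
    exact hc.neg_mul_atTop hneg (tendsto_inv_nhdsGT_zero.comp tendsto_one_sub)
  have h2 := h.mul hE
  rw [mul_zero] at h2
  refine h2.congr' ?_
  filter_upwards [Ioo_mem_nhdsLT (show (0 : ℝ) < 1 by norm_num)] with t ht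
  rw [hhVal_eq hx hy ht.1 ht.2]

theorem t_to_s {v : ℝ → ℝ} {C : ℝ} (h : Tendsto (fun t => √(1 - t) * v t) (𝓝[<] 1) (𝓝 C)) :
    Tendsto (fun s => √s * v (Real.exp (-s))) (𝓝[>] 0) (𝓝 C) := by
  have he : Tendsto (fun s : ℝ => Real.exp (-s)) (𝓝[>] 0) (𝓝[<] 1) := by
    refine tendsto_nhdsWithin_iff.mpr ⟨?_, ?_⟩
    · have : Tendsto (fun s : ℝ => Real.exp (-s)) (𝓝 0) (𝓝 (Real.exp (-0))) :=
        (by fun_prop : Continuous (fun s : ℝ => Real.exp (-s))).tendsto 0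
      rw [neg_zero, Real.exp_zero] at this
      exact this.mono_left nhdsWithin_le_nhds
    · filter_upwards [self_mem_nhdsWithin] with s hs
      have : 0 < s := hs
      simpa using this
  have hd : Tendsto (fun s : ℝ => (1 - Real.exp (-s)) / s) (𝓝[>] 0) (𝓝 1) := by
    have h1 : HasDerivAt (fun s : ℝ => 1 - Real.exp (-s)) 1 0 := by
      have := ((hasDerivAt_neg (0 : ℝ)).exp).const_sub 1
      simpa using this
    have := h1.tendsto_slope_zero_right
    refine this.congr fun s => ?_
    simp [div_eq_inv_mul]
  have hd2 : Tendsto (fun s : ℝ => √(((1 - Real.exp (-s)) / s)⁻¹)) (𝓝[>] 0) (𝓝 1) := by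
    have := (hd.inv₀ one_ne_zero).sqrt
    simpa using this
  have := hd2.mul (h.comp he)
  rw [one_mul] at this
  refine this.congr' ?_
  filter_upwards [self_mem_nhdsWithin] with s hs
  have hs' : 0 < s := hs
  have h3 : 0 < 1 - Real.exp (-s) := by simpa using hs'
  simp only [Function.comp]
  rw [← mul_assoc, ← Real.sqrt_mul (by positivity)]
  congr 2
  field_simp

/-- The limiting functional. -/
noncomputable def Lam (C : ℝ) (f : ℝ → ℝ) : ℝ :=
  C / √Real.pi * ∫ v in Set.Ioi (0 : ℝ), (Real.exp (-v) * v ^ ((1 / 2 : ℝ) - 1)) * f (Real.exp (-v))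

/-- The approximating functionals. -/
noncomputable def Tfun (b : ℕ → ℝ) (s : ℝ) (f : ℝ → ℝ) : ℝ :=
  √s * ∑' n, b n * Real.exp (-s) ^ n * f (Real.exp (-s) ^ n)

theorem w_int : MeasureTheory.IntegrableOn (fun v : ℝ => Real.exp (-v) * v ^ ((1 / 2 : ℝ) - 1))
    (Set.Ioi 0) := Real.GammaIntegral_convergent (by norm_num)

theorem cont_bdd {f : ℝ → ℝ} (hf : Continuous f) : ∃ M, 0 ≤ M ∧ ∀ r ∈ Set.Icc (0 : ℝ) 1, |f r| ≤ M := by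
  obtain ⟨M, hM⟩ := (isCompact_Icc (a := (0 : ℝ)) (b := 1)).exists_bound_of_continuousOn hf.continuousOn
  exact ⟨M, (norm_nonneg _).trans (hM 0 (by simp)), hM⟩

theorem wf_int {f : ℝ → ℝ} (hf : Continuous f) :
    MeasureTheory.IntegrableOn (fun v : ℝ => (Real.exp (-v) * v ^ ((1 / 2 : ℝ) - 1)) * f (Real.exp (-v)))
    (Set.Ioi 0) := by
  obtain ⟨M, _, hM⟩ := cont_bdd hf
  refine MeasureTheory.Integrable.mul_bdd (c := M) w_int
    (hf.comp (by fun_prop : Continuous fun v : ℝ => Real.exp (-v))).aestronglyMeasurable ?_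
  refine (MeasureTheory.ae_restrict_iff' measurableSet_Ioi).mpr (Filter.Eventually.of_forall ?_)
  intro v hv
  have : (0 : ℝ) < v := hv
  exact hM _ ⟨(Real.exp_pos _).le, by simpa using this.le⟩

theorem Lam_monomial (C : ℝ) (k : ℕ) : Lam C (fun r => r ^ k) = C / √((k : ℝ) + 1) := by
  unfold Lam
  have h := Real.integral_rpow_mul_exp_neg_mul_Ioi (a := 1 / 2) (r := (k : ℝ) + 1) (by norm_num)
    (by positivity)
  have e : ∀ v : ℝ, (Real.exp (-v) * v ^ ((1 / 2 : ℝ) - 1)) * Real.exp (-v) ^ k =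
      v ^ ((1 / 2 : ℝ) - 1) * Real.exp (-(((k : ℝ) + 1) * v)) := by
    intro v
    rw [← Real.exp_nat_mul, show -(((k : ℝ) + 1) * v) = -v + k * -v by ring, Real.exp_add]
    ring
  simp only [e]
  rw [h, Real.Gamma_one_half_eq, ← Real.sqrt_eq_rpow, one_div ((k : ℝ) + 1), Real.sqrt_inv]
  have : √Real.pi ≠ 0 := by positivity
  field_simp

theorem Lam_add (C : ℝ) {f g : ℝ → ℝ} (hf : Continuous f) (hg : Continuous g) :
    Lam C (fun r => f r + g r) = Lam C f + Lam C g := by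
  unfold Lam
  simp only [mul_add]
  rw [MeasureTheory.integral_add (wf_int hf) (wf_int hg)]
  ring

theorem Lam_smul (C c : ℝ) (f : ℝ → ℝ) :
    Lam C (fun r => c * f r) = c * Lam C f := by
  unfold Lam
  simp only [mul_left_comm _ c]
  rw [MeasureTheory.integral_const_mul]
  ring

theorem exp_pow_mem {s : ℝ} (hs : 0 < s) (n : ℕ) : Real.exp (-s) ^ n ∈ Set.Icc (0 : ℝ) 1 :=
  ⟨by positivity, pow_le_one₀ (by positivity) (by simpa using hs.le)⟩

section kar

variable {b : ℕ → ℝ} {C : ℝ}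

theorem T_summable (hb : ∀ n, 0 ≤ b n) (hs : ∀ s : ℝ, 0 < s → Summable (fun n => b n * Real.exp (-s) ^ n))
    {f : ℝ → ℝ} (hf : Continuous f) {s : ℝ} (h : 0 < s) :
    Summable (fun n => b n * Real.exp (-s) ^ n * f (Real.exp (-s) ^ n)) := by
  obtain ⟨M, _, hM⟩ := cont_bdd hf
  refine Summable.of_norm_bounded ((hs s h).mul_right M) fun n => ?_
  have h1 : 0 ≤ b n * Real.exp (-s) ^ n := mul_nonneg (hb n) (by positivity)
  rw [norm_mul, Real.norm_of_nonneg h1]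
  exact mul_le_mul_of_nonneg_left (hM _ (exp_pow_mem h n)) h1

theorem T_poly (hb : ∀ n, 0 ≤ b n) (hs : ∀ s : ℝ, 0 < s → Summable (fun n => b n * Real.exp (-s) ^ n))
    (hC : Tendsto (fun s => √s * ∑' n, b n * Real.exp (-s) ^ n) (𝓝[>] 0) (𝓝 C))
    (P : Polynomial ℝ) :
    Tendsto (fun s => Tfun b s (fun r => P.eval r)) (𝓝[>] 0) (𝓝 (Lam C (fun r => P.eval r))) := by
  induction P using Polynomial.induction_on' with
  | add p q hp hq =>
    simp only [Polynomial.eval_add]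
    rw [Lam_add C p.continuous q.continuous]
    refine (hp.add hq).congr' ?_
    filter_upwards [self_mem_nhdsWithin] with s hs0
    unfold Tfun
    simp only [mul_add]
    rw [(T_summable hb hs p.continuous hs0).tsum_add (T_summable hb hs q.continuous hs0), mul_add]
  | monomial k a =>
    simp only [Polynomial.eval_monomial]
    rw [Lam_smul, Lam_monomial]
    have hk : (0 : ℝ) < (k : ℝ) + 1 := by positivity
    have hlin : Tendsto (fun s : ℝ => ((k : ℝ) + 1) * s) (𝓝[>] 0) (𝓝[>] 0) := by
      refine tendsto_nhdsWithin_iff.mpr ⟨?_, ?_⟩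
      · have : Tendsto (fun s : ℝ => ((k : ℝ) + 1) * s) (𝓝 0) (𝓝 (((k : ℝ) + 1) * 0)) :=
          (continuous_const.mul continuous_id).tendsto 0
        rw [mul_zero] at this
        exact this.mono_left nhdsWithin_le_nhds
      · filter_upwards [self_mem_nhdsWithin] with s hs
        exact mul_pos hk hs
    have h := ((hC.comp hlin).div_const (√((k : ℝ) + 1))).const_mul a
    refine h.congr' ?_
    filter_upwards [self_mem_nhdsWithin] with s hs0
    unfold Tfun
    have e : ∀ n, b n * Real.exp (-s) ^ n * (a * (Real.exp (-s) ^ n) ^ k) =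
        a * (b n * Real.exp (-(((k : ℝ) + 1) * s)) ^ n) := by
      intro n
      have : Real.exp (-(((k : ℝ) + 1) * s)) = Real.exp (-s) ^ (k + 1) := by
        rw [← Real.exp_nat_mul]; push_cast; congr 1; ring
      rw [this, ← pow_mul, ← pow_mul]
      ring
    simp only [e, tsum_mul_left, Function.comp]
    rw [Real.sqrt_mul hk.le]
    have : √((k : ℝ) + 1) ≠ 0 := by positivity
    field_simp

theorem T_cont (hb : ∀ n, 0 ≤ b n) (hs : ∀ s : ℝ, 0 < s → Summable (fun n => b n * Real.exp (-s) ^ n))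
    (hC : Tendsto (fun s => √s * ∑' n, b n * Real.exp (-s) ^ n) (𝓝[>] 0) (𝓝 C))
    {f : ℝ → ℝ} (hf : Continuous f) :
    Tendsto (fun s => Tfun b s f) (𝓝[>] 0) (𝓝 (Lam C f)) := by
  have hC0 : 0 ≤ C := by
    refine ge_of_tendsto hC ?_
    filter_upwards with s
    exact mul_nonneg (Real.sqrt_nonneg _) (tsum_nonneg fun n => mul_nonneg (hb n) (by positivity))
  have hL1 : Lam C (fun _ => 1) = C := by
    have := Lam_monomial C 0
    simpa using this
  rw [Metric.tendsto_nhds]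
  intro ε hε
  set η := ε / (2 * (2 * C + 2)) with hη
  have hη0 : 0 < η := by positivity
  obtain ⟨P, hP⟩ := exists_polynomial_near_of_continuousOn 0 1 f hf.continuousOn η hη0
  have h1 := Metric.tendsto_nhds.mp (T_poly hb hs hC P) (ε / 2) (by linarith)
  have h2 := (tendsto_order.mp hC).2 (C + 1) (by linarith)
  have hLam : |Lam C (fun r => P.eval r) - Lam C f| ≤ η * C := by
    have e : Lam C (fun r => P.eval r) - Lam C f = Lam C (fun r => P.eval r + (-1) * f r) := by
      rw [Lam_add C P.continuous (by fun_prop), Lam_smul]; ring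
    rw [e]
    calc |Lam C (fun r => P.eval r + (-1) * f r)| ≤ Lam C (fun _ => η * 1) := by
          unfold Lam
          rw [abs_mul, abs_of_nonneg (by positivity)]
          refine mul_le_mul_of_nonneg_left ?_ (by positivity)
          rw [← Real.norm_eq_abs]
          refine MeasureTheory.norm_integral_le_of_norm_le (wf_int continuous_const) ?_
          refine (MeasureTheory.ae_restrict_iff' measurableSet_Ioi).mpr (Filter.Eventually.of_forall ?_)
          intro v hv
          have hv0 : (0 : ℝ) < v := hv
          have := hP (Real.exp (-v)) ⟨(Real.exp_pos _).le, by simpa using hv0.le⟩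
          rw [norm_mul, Real.norm_of_nonneg (by positivity)]
          refine mul_le_mul_of_nonneg_left ?_ (by positivity)
          show ‖Polynomial.eval (Real.exp (-v)) P + (-1) * f (Real.exp (-v))‖ ≤ η * 1
          rw [Real.norm_eq_abs, mul_one, neg_one_mul, ← sub_eq_add_neg]
          exact this.le
      _ = η * C := by rw [Lam_smul, hL1]
  filter_upwards [h1, h2, self_mem_nhdsWithin] with s h1 h2 hs0
  have hs0' : 0 < s := hs0
  have hT : |Tfun b s f - Tfun b s (fun r => P.eval r)| ≤ η * (C + 1) := by
    unfold Tfun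
    rw [← mul_sub, ← (T_summable hb hs hf hs0').tsum_sub (T_summable hb hs P.continuous hs0'), abs_mul,
      abs_of_nonneg (Real.sqrt_nonneg _)]
    have hbd : ‖∑' n, (b n * Real.exp (-s) ^ n * f (Real.exp (-s) ^ n) -
        b n * Real.exp (-s) ^ n * P.eval (Real.exp (-s) ^ n))‖ ≤
        η * ∑' n, b n * Real.exp (-s) ^ n := by
      refine tsum_of_norm_bounded ((hs s hs0').hasSum.mul_left η) fun n => ?_
      have h3 : 0 ≤ b n * Real.exp (-s) ^ n := mul_nonneg (hb n) (by positivity)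
      rw [← mul_sub, norm_mul, Real.norm_of_nonneg h3, mul_comm η]
      refine mul_le_mul_of_nonneg_left ?_ h3
      rw [Real.norm_eq_abs, abs_sub_comm]
      exact (hP _ (exp_pow_mem hs0' n)).le
    rw [Real.norm_eq_abs] at hbd
    calc _ ≤ √s * (η * ∑' n, b n * Real.exp (-s) ^ n) := by gcongr
      _ = η * (√s * ∑' n, b n * Real.exp (-s) ^ n) := by ring
      _ ≤ η * (C + 1) := by gcongr
  rw [Real.dist_eq] at *
  have e3 : η * (2 * C + 2) = ε / 2 := by rw [hη]; field_simp
  have a1 := abs_lt.mp h1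
  have a2 := abs_le.mp hT
  have a3 := abs_le.mp hLam
  rw [abs_lt]
  constructor <;> nlinarith

end kar

/-- trapezoidal cut-off in the variable `v`. -/
noncomputable def cutv (a c v : ℝ) : ℝ := max 0 (min 1 ((c - v) / (c - a)))

/-- the corresponding test function of `r = e^{-v}`. -/
noncomputable def cutr (a c r : ℝ) : ℝ :=
  cutv a c (-Real.log (max r (Real.exp (-c)))) / max r (Real.exp (-c))

theorem cutv_zero {a c v : ℝ} (h : a < c) (hv : c ≤ v) : cutv a c v = 0 := by
  unfold cutv
  apply max_eq_left
  refine (min_le_right _ _).trans ?_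
  exact div_nonpos_of_nonpos_of_nonneg (by linarith) (by linarith)

theorem cutv_one {a c v : ℝ} (h : a < c) (hv : v ≤ a) : cutv a c v = 1 := by
  unfold cutv
  rw [min_eq_left, max_eq_right zero_le_one]
  rw [le_div_iff₀ (by linarith)]
  linarith

theorem cutv_nonneg (a c v : ℝ) : 0 ≤ cutv a c v := le_max_left _ _

theorem cutv_le_one (a c v : ℝ) : cutv a c v ≤ 1 := max_le zero_le_one (min_le_left _ _)

theorem cutr_cont (a c : ℝ) : Continuous (cutr a c) := by
  have hpos : ∀ r : ℝ, 0 < max r (Real.exp (-c)) := fun r => lt_max_of_lt_right (Real.exp_pos _)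
  have h1 : Continuous fun r : ℝ => Real.log (max r (Real.exp (-c))) :=
    (continuous_id.max continuous_const).log fun r => (hpos r).ne'
  have h2 : Continuous (cutv a c) := by unfold cutv; fun_prop
  exact (h2.comp h1.neg).div (continuous_id.max continuous_const) fun r => (hpos r).ne'

theorem cutr_exp {a c : ℝ} (h : a < c) (v : ℝ) :
    Real.exp (-v) * cutr a c (Real.exp (-v)) = cutv a c v := by
  unfold cutr
  rcases le_total v c with hv | hv
  · rw [max_eq_left (Real.exp_le_exp.mpr (by linarith)), Real.log_exp, neg_neg]
    field_simp
  · rw [max_eq_right (Real.exp_le_exp.mpr (by linarith)), Real.log_exp, neg_neg, cutv_zero h hv,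
      cutv_zero h le_rfl]
    simp

theorem int_rpow {a : ℝ} (ha : 0 < a) :
    ∫ v in Set.Ioi (0 : ℝ), Set.indicator (Set.Ioc 0 a) (fun v => v ^ ((1 / 2 : ℝ) - 1)) v = 2 * √a := by
  rw [MeasureTheory.setIntegral_indicator measurableSet_Ioc,
    Set.inter_eq_self_of_subset_right Set.Ioc_subset_Ioi_self,
    ← intervalIntegral.integral_of_le ha.le, integral_rpow (Or.inl (by norm_num)), Real.sqrt_eq_rpow]
  norm_num
  ring

theorem int_rpow_int {a : ℝ} (ha : 0 < a) :
    MeasureTheory.IntegrableOn (Set.indicator (Set.Ioc 0 a) (fun v => v ^ ((1 / 2 : ℝ) - 1)))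
      (Set.Ioi (0 : ℝ)) := by
  rw [MeasureTheory.integrableOn_indicator_iff measurableSet_Ioc,
    Set.inter_eq_self_of_subset_left Set.Ioc_subset_Ioi_self,
    ← intervalIntegrable_iff_integrableOn_Ioc_of_le ha.le]
  exact intervalIntegral.intervalIntegrable_rpow' (by norm_num)

theorem cut_integrand {a c : ℝ} (h : a < c) (v : ℝ) :
    (Real.exp (-v) * v ^ ((1 / 2 : ℝ) - 1)) * cutr a c (Real.exp (-v)) =
      v ^ ((1 / 2 : ℝ) - 1) * cutv a c v := by
  rw [← cutr_exp h]; ring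

theorem Lam_cut_le {a c C : ℝ} (hC : 0 ≤ C) (ha : 0 < a) (h : a < c) :
    Lam C (cutr a c) ≤ 2 * C / √Real.pi * √c := by
  have hc : 0 < c := ha.trans h
  unfold Lam
  rw [show 2 * C / √Real.pi * √c = C / √Real.pi * (2 * √c) by ring, ← int_rpow hc]
  refine mul_le_mul_of_nonneg_left ?_ (by positivity)
  refine MeasureTheory.setIntegral_mono_on (wf_int (cutr_cont a c)) (int_rpow_int hc)
    measurableSet_Ioi fun v hv => ?_
  have hv0 : (0 : ℝ) < v := hv
  rw [cut_integrand h]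
  by_cases hvc : v ≤ c
  · rw [Set.indicator_of_mem (show v ∈ Set.Ioc 0 c from ⟨hv0, hvc⟩)]
    exact mul_le_of_le_one_right (by positivity) (cutv_le_one _ _ _)
  · rw [Set.indicator_of_notMem (fun hh => hvc hh.2), cutv_zero h (not_le.mp hvc).le, mul_zero]

theorem Lam_cut_ge {a c C : ℝ} (hC : 0 ≤ C) (ha : 0 < a) (h : a < c) :
    2 * C / √Real.pi * √a ≤ Lam C (cutr a c) := by
  unfold Lam
  rw [show 2 * C / √Real.pi * √a = C / √Real.pi * (2 * √a) by ring, ← int_rpow ha]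
  refine mul_le_mul_of_nonneg_left ?_ (by positivity)
  refine MeasureTheory.setIntegral_mono_on (int_rpow_int ha) (wf_int (cutr_cont a c))
    measurableSet_Ioi fun v hv => ?_
  have hv0 : (0 : ℝ) < v := hv
  rw [cut_integrand h]
  by_cases hvc : v ≤ a
  · rw [Set.indicator_of_mem (show v ∈ Set.Ioc 0 a from ⟨hv0, hvc⟩), cutv_one h hvc, mul_one]
  · rw [Set.indicator_of_notMem (fun hh => hvc hh.2)]
    exact mul_nonneg (by positivity) (cutv_nonneg _ _ _)

theorem T_cut (b : ℕ → ℝ) {a c : ℝ} (h : a < c) (s : ℝ) (n : ℕ) :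
    b n * Real.exp (-s) ^ n * cutr a c (Real.exp (-s) ^ n) = b n * cutv a c (n * s) := by
  rw [← cutr_exp h, ← Real.exp_nat_mul, mul_neg, mul_assoc]

theorem karamata {b : ℕ → ℝ} {C : ℝ} (hb : ∀ n, 0 ≤ b n)
    (hs : ∀ s : ℝ, 0 < s → Summable (fun n => b n * Real.exp (-s) ^ n))
    (hC : Tendsto (fun s => √s * ∑' n, b n * Real.exp (-s) ^ n) (𝓝[>] 0) (𝓝 C)) :
    Tendsto (fun N : ℕ => (∑ n ∈ Finset.range (N + 1), b n) / √(N : ℝ)) atTop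
      (𝓝 (2 * C / √Real.pi)) := by
  have hC0 : 0 ≤ C := by
    refine ge_of_tendsto hC ?_
    filter_upwards with s
    exact mul_nonneg (Real.sqrt_nonneg _) (tsum_nonneg fun n => mul_nonneg (hb n) (by positivity))
  have hN : Tendsto (fun N : ℕ => ((N : ℝ))⁻¹) atTop (𝓝[>] 0) :=
    tendsto_inv_atTop_nhdsGT_zero.comp tendsto_natCast_atTop_atTop
  have hsq : ∀ w : ℝ → ℝ, ContinuousAt w 0 → w 0 = 1 → Tendsto (fun δ : ℝ => 2 * C / √Real.pi * √(w δ)) (𝓝[>] 0)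
      (𝓝 (2 * C / √Real.pi)) := by
    intro w hw hw0
    have := (hw.tendsto.sqrt).const_mul (2 * C / √Real.pi)
    rw [hw0, Real.sqrt_one, mul_one] at this
    exact this.mono_left nhdsWithin_le_nhds
  rw [tendsto_order]
  constructor
  · intro q hq
    have h1 := (tendsto_order.mp (hsq (fun δ => 1 - δ) (by fun_prop) (by simp))).1 q hq
    obtain ⟨δ, hδ, hδ0⟩ := (h1.and (Ioo_mem_nhdsGT (show (0 : ℝ) < 1 by norm_num))).exists
    have hac : 1 - δ < 1 := by linarith [hδ0.1]
    have hl := hδ.trans_le (Lam_cut_ge hC0 (by linarith [hδ0.2]) hac)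
    have h2 := (tendsto_order.mp ((T_cont hb hs hC (cutr_cont (1 - δ) 1)).comp hN)).1 q hl
    filter_upwards [h2, eventually_gt_atTop 0] with N h2 hN0
    have hN' : (0 : ℝ) < N := by exact_mod_cast hN0
    refine h2.trans_le ?_
    simp only [Function.comp, Tfun, T_cut b hac]
    rw [Real.sqrt_inv, ← div_eq_inv_mul]
    gcongr
    rw [tsum_eq_sum (s := Finset.range (N + 1))]
    · refine Finset.sum_le_sum fun n _ => mul_le_of_le_one_right (hb n) (cutv_le_one _ _ _)
    · intro n hn
      rw [cutv_zero hac, mul_zero]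
      have : N + 1 ≤ n := by simpa using hn
      have : (N : ℝ) + 1 ≤ n := by exact_mod_cast this
      rw [← div_eq_mul_inv, le_div_iff₀ hN']
      linarith
  · intro q hq
    have h1 := (tendsto_order.mp (hsq (fun δ => 1 + δ) (by fun_prop) (by simp))).2 q hq
    obtain ⟨δ, hδ, hδ0⟩ := (h1.and (Ioo_mem_nhdsGT (show (0 : ℝ) < 1 by norm_num))).exists
    have hac : 1 < 1 + δ := by linarith [hδ0.1]
    have hl := (Lam_cut_le hC0 one_pos hac).trans_lt hδ
    have h2 := (tendsto_order.mp ((T_cont hb hs hC (cutr_cont 1 (1 + δ))).comp hN)).2 q hl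
    filter_upwards [h2, eventually_gt_atTop 0] with N h2 hN0
    have hN' : (0 : ℝ) < N := by exact_mod_cast hN0
    refine lt_of_le_of_lt ?_ h2
    have hsm := T_summable hb hs (cutr_cont 1 (1 + δ)) (inv_pos.mpr hN')
    simp only [T_cut b hac] at hsm
    simp only [Function.comp, Tfun, T_cut b hac]
    rw [Real.sqrt_inv, ← div_eq_inv_mul]
    gcongr
    refine le_trans (le_of_eq ?_) (hsm.sum_le_tsum (Finset.range (N + 1))
      fun n _ => mul_nonneg (hb n) (cutv_nonneg _ _ _))
    refine Finset.sum_congr rfl fun n hn => ?_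
    rw [cutv_one hac, mul_one]
    have : n ≤ N := by simpa [Nat.lt_succ_iff] using hn
    have : (n : ℝ) ≤ N := by exact_mod_cast this
    rw [← div_eq_mul_inv, div_le_iff₀ hN']
    linarith

/-- telescoping weights -/
noncomputable def dT (n : ℕ) : ℝ := 1 / √(n : ℝ) - 1 / √((n : ℝ) + 1)

theorem dT_nonneg {n : ℕ} (hn : 0 < n) : 0 ≤ dT n := by
  have : (0 : ℝ) < n := by exact_mod_cast hn
  unfold dT
  rw [sub_nonneg]
  apply one_div_le_one_div_of_le (by positivity)
  apply Real.sqrt_le_sqrt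
  linarith

theorem dT_hasSum (N : ℕ) : HasSum (fun i => dT (i + N + 1)) (1 / √((N : ℝ) + 1)) := by
  rw [hasSum_iff_tendsto_nat_of_nonneg (fun i => dT_nonneg (by omega))]
  have h : ∀ M : ℕ, ∑ i ∈ Finset.range M, dT (i + N + 1) =
      1 / √((N : ℝ) + 1) - 1 / √((M : ℝ) + N + 1) := by
    intro M
    induction M with
    | zero => simp
    | succ M ih =>
      rw [Finset.sum_range_succ, ih, dT]
      push_cast
      rw [show (M : ℝ) + 1 + N + 1 = M + N + 1 + 1 by ring]
      ring
  simp only [h]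
  have h2 : Tendsto (fun M : ℕ => 1 / √((M : ℝ) + N + 1)) atTop (𝓝 0) := by
    simp only [one_div]
    refine tendsto_inv_atTop_zero.comp (Real.tendsto_sqrt_atTop.comp ?_)
    simp only [add_assoc]
    exact tendsto_atTop_add_const_right _ _ tendsto_natCast_atTop_atTop
  simpa using h2.const_sub (1 / √((N : ℝ) + 1))

theorem sqrt_ratio : Tendsto (fun N : ℕ => √(N : ℝ) * (1 / √((N : ℝ) + 1))) atTop (𝓝 1) := by
  have h := (tendsto_natCast_div_add_atTop (𝕜 := ℝ) 1).sqrt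
  rw [Real.sqrt_one] at h
  refine h.congr fun N => ?_
  rw [Real.sqrt_div (Nat.cast_nonneg N)]
  ring

theorem tail_d {q : ℕ → ℝ} {Q : ℝ} (hq : Tendsto q atTop (𝓝 Q)) :
    (∀ N : ℕ, Summable (fun i => q (i + N + 1) * dT (i + N + 1))) ∧
    Tendsto (fun N : ℕ => √(N : ℝ) * ∑' i, q (i + N + 1) * dT (i + N + 1)) atTop (𝓝 Q) := by
  have hsum : ∀ N : ℕ, Summable (fun i => q (i + N + 1) * dT (i + N + 1)) := by
    intro N
    obtain ⟨M, hM⟩ := (Metric.isBounded_range_of_tendsto q hq).exists_norm_le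
    refine Summable.of_norm_bounded ((dT_hasSum N).summable.mul_left M) fun i => ?_
    rw [norm_mul, Real.norm_of_nonneg (dT_nonneg (by omega))]
    exact mul_le_mul_of_nonneg_right (hM _ ⟨_, rfl⟩) (dT_nonneg (by omega))
  refine ⟨hsum, ?_⟩
  have key : Tendsto (fun N : ℕ => √(N : ℝ) * ∑' i, (q (i + N + 1) - Q) * dT (i + N + 1)) atTop (𝓝 0) := by
    rw [Metric.tendsto_atTop]
    intro ε hε
    obtain ⟨N0, hN0⟩ := Metric.tendsto_atTop.mp hq (ε / 2) (by linarith)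
    refine ⟨N0, fun N hN => ?_⟩
    rw [Real.dist_eq, sub_zero, abs_mul, abs_of_nonneg (Real.sqrt_nonneg _)]
    have hb : ‖∑' i, (q (i + N + 1) - Q) * dT (i + N + 1)‖ ≤ ε / 2 * (1 / √((N : ℝ) + 1)) := by
      refine tsum_of_norm_bounded ((dT_hasSum N).mul_left (ε / 2)) fun i => ?_
      rw [norm_mul, Real.norm_of_nonneg (dT_nonneg (by omega))]
      refine mul_le_mul_of_nonneg_right ?_ (dT_nonneg (by omega))
      have := hN0 (i + N + 1) (by omega)
      rw [Real.dist_eq] at this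
      exact this.le
    rw [Real.norm_eq_abs] at hb
    have hle : √(N : ℝ) * (1 / √((N : ℝ) + 1)) ≤ 1 := by
      rw [mul_one_div, div_le_one (by positivity)]
      exact Real.sqrt_le_sqrt (by linarith)
    calc _ ≤ √(N : ℝ) * (ε / 2 * (1 / √((N : ℝ) + 1))) := by gcongr
      _ = ε / 2 * (√(N : ℝ) * (1 / √((N : ℝ) + 1))) := by ring
      _ ≤ ε / 2 * 1 := by gcongr
      _ < ε := by linarith
  have h2 := key.add (sqrt_ratio.const_mul Q)
  rw [mul_one, zero_add] at h2
  refine h2.congr fun N => ?_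
  have e : ∀ i, (q (i + N + 1) - Q) * dT (i + N + 1) =
      q (i + N + 1) * dT (i + N + 1) - Q * dT (i + N + 1) := fun i => by ring
  simp only [e]
  rw [(hsum N).tsum_sub ((dT_hasSum N).summable.mul_left Q), tsum_mul_left, (dT_hasSum N).tsum_eq]
  ring

theorem tail_of_partial {b : ℕ → ℝ} {K : ℝ} (hb : ∀ n, 0 ≤ b n)
    (hS : Tendsto (fun N : ℕ => (∑ n ∈ Finset.range (N + 1), b n) / √(N : ℝ)) atTop (𝓝 K)) :
    (∀ N : ℕ, Summable (fun i => b (i + N + 1) / ((i + N + 1 : ℕ) : ℝ))) ∧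
    Tendsto (fun N : ℕ => √(N : ℝ) * ∑' i, b (i + N + 1) / ((i + N + 1 : ℕ) : ℝ)) atTop (𝓝 K) := by
  set S : ℕ → ℝ := fun N => ∑ n ∈ Finset.range (N + 1), b n with hSdef
  have hq : Tendsto (fun n : ℕ => S n / √(n : ℝ) * (1 + √(n : ℝ) * (1 / √((n : ℝ) + 1)))) atTop
      (𝓝 (K * (1 + 1))) := hS.mul (sqrt_ratio.const_add 1)
  obtain ⟨h1, h2⟩ := tail_d hq
  have hterm : ∀ n : ℕ, 0 < n → S n / √(n : ℝ) * (1 + √(n : ℝ) * (1 / √((n : ℝ) + 1))) * dT n =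
      S n / (n * (n + 1)) := by
    intro n hn
    have hn' : (0 : ℝ) < n := by exact_mod_cast hn
    unfold dT
    have a1 := Real.sq_sqrt hn'.le
    have a2 := Real.sq_sqrt (show (0 : ℝ) ≤ n + 1 by positivity)
    have p1 : 0 < √(n : ℝ) := Real.sqrt_pos.mpr hn'
    have p2 : 0 < √((n : ℝ) + 1) := by positivity
    generalize √(n : ℝ) = r at *
    generalize √((n : ℝ) + 1) = w at *
    rw [← a1] at a2
    rw [← a1, ← a2]
    field_simp
    linear_combination (S n) * a2
  have hpart : ∀ N : ℕ, HasSum (fun i => b (i + N + 1) / ((i + N + 1 : ℕ) : ℝ))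
      (-(S N / ((N : ℝ) + 1)) + ∑' i, S (i + N + 1) / √((i + N + 1 : ℕ) : ℝ) *
        (1 + √((i + N + 1 : ℕ) : ℝ) * (1 / √(((i + N + 1 : ℕ) : ℝ) + 1))) * dT (i + N + 1)) := by
    intro N
    rw [hasSum_iff_tendsto_nat_of_nonneg (fun i => div_nonneg (hb _) (Nat.cast_nonneg _))]
    have h : ∀ M : ℕ, ∑ i ∈ Finset.range M, b (i + N + 1) / ((i + N + 1 : ℕ) : ℝ) =
        S (M + N) / ((M : ℝ) + N + 1) + -(S N / ((N : ℝ) + 1)) +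
        ∑ i ∈ Finset.range M, S (i + N + 1) / √((i + N + 1 : ℕ) : ℝ) *
        (1 + √((i + N + 1 : ℕ) : ℝ) * (1 / √(((i + N + 1 : ℕ) : ℝ) + 1))) * dT (i + N + 1) := by
      intro M
      induction M with
      | zero => simp
      | succ M ih =>
        rw [Finset.sum_range_succ, ih, Finset.sum_range_succ, hterm _ (by omega)]
        have hs : S (M + N + 1) = S (M + N) + b (M + N + 1) := Finset.sum_range_succ _ _
        rw [show M + 1 + N = M + N + 1 by ring, hs]
        push_cast
        have : (M : ℝ) + N + 1 ≠ 0 := by positivity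
        have : (M : ℝ) + N + 1 + 1 ≠ 0 := by positivity
        rw [show (M : ℝ) + 1 + N + 1 = M + N + 1 + 1 by ring]
        field_simp
        ring
    simp only [h]
    refine Tendsto.add ?_ (h1 N).hasSum.tendsto_sum_nat
    have hz : Tendsto (fun n : ℕ => S n / ((n : ℝ) + 1)) atTop (𝓝 0) := by
      have h3 : Tendsto (fun n : ℕ => 1 / √((n : ℝ) + 1)) atTop (𝓝 0) := by
        simp only [one_div]
        refine tendsto_inv_atTop_zero.comp (Real.tendsto_sqrt_atTop.comp ?_)
        exact tendsto_atTop_add_const_right _ _ tendsto_natCast_atTop_atTop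
      have h4 := (hS.mul sqrt_ratio).mul h3
      rw [mul_zero] at h4
      refine h4.congr' ?_
      filter_upwards [eventually_gt_atTop 0] with n hn
      have hn' : (0 : ℝ) < n := by exact_mod_cast hn
      have p1 : 0 < √(n : ℝ) := Real.sqrt_pos.mpr hn'
      have a2 := Real.sq_sqrt (show (0 : ℝ) ≤ n + 1 by positivity)
      have p2 : 0 < √((n : ℝ) + 1) := by positivity
      generalize √((n : ℝ) + 1) = w at *
      rw [← a2]
      field_simp
      rfl
    have hz2 := (hz.comp (tendsto_add_atTop_nat N)).add_const (-(S N / ((N : ℝ) + 1)))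
    rw [zero_add] at hz2
    refine hz2.congr fun M => ?_
    simp
  refine ⟨fun N => (hpart N).summable, ?_⟩
  have h5 : Tendsto (fun N : ℕ => √(N : ℝ) * (S N / ((N : ℝ) + 1))) atTop (𝓝 K) := by
    have := hS.mul (sqrt_ratio.mul sqrt_ratio)
    rw [mul_one, mul_one] at this
    refine this.congr' ?_
    filter_upwards [eventually_gt_atTop 0] with n hn
    have hn' : (0 : ℝ) < n := by exact_mod_cast hn
    have p1 : 0 < √(n : ℝ) := Real.sqrt_pos.mpr hn'
    have a2 := Real.sq_sqrt (show (0 : ℝ) ≤ n + 1 by positivity)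
    have p2 : 0 < √((n : ℝ) + 1) := by positivity
    generalize √((n : ℝ) + 1) = w at *
    rw [← a2]
    field_simp
    rfl
  have h6 := h2.sub h5
  rw [show K * (1 + 1) - K = K by ring] at h6
  refine h6.congr fun N => ?_
  rw [(hpart N).tsum_eq]
  ring

/-- The normalized products. -/
noncomputable def bb (α x y : ℝ) (n : ℕ) : ℝ :=
  n.factorial / Real.Gamma ((n:ℝ)+α+1) * assocLaguerre α n x * assocLaguerre α n y

theorem bb_hasSum {α : ℝ} (hα : -1 < α) (x y : ℝ) {s : ℝ} (hs : 0 < s) :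
    HasSum (fun n => bb α x y n * Real.exp (-s) ^ n) (hhVal α x y (Real.exp (-s))) :=
  hille_hardy hα x y (Real.exp_pos _).le (by simpa using hs)

theorem bb_diag_lim {α : ℝ} (hα : -1 < α) {x : ℝ} (hx : 0 < x) :
    Tendsto (fun s => √s * ∑' n, bb α x x n * Real.exp (-s) ^ n) (𝓝[>] 0)
      (𝓝 (1/(2*√Real.pi) * x^(-α-1/2) * Real.exp x)) := by
  refine (t_to_s (hh_diag_t hα hx)).congr' ?_
  filter_upwards [self_mem_nhdsWithin] with s hs
  rw [(bb_hasSum hα x x hs).tsum_eq]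

theorem bb_nonneg {α : ℝ} (hα : -1 < α) (x : ℝ) (n : ℕ) : 0 ≤ bb α x x n := by
  have := gam_pos hα n
  unfold bb
  rw [mul_assoc]
  exact mul_nonneg (by positivity) (mul_self_nonneg _)

theorem bb_diag {α : ℝ} (hα : -1 < α) {x : ℝ} (hx : 0 < x) :
    (∀ N : ℕ, Summable (fun i => bb α x x (i + N + 1) / ((i + N + 1 : ℕ) : ℝ))) ∧
    Tendsto (fun N : ℕ => √(N : ℝ) * ∑' i, bb α x x (i + N + 1) / ((i + N + 1 : ℕ) : ℝ)) atTop
      (𝓝 (2 * (1/(2*√Real.pi) * x^(-α-1/2) * Real.exp x) / √Real.pi)) :=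
  tail_of_partial (bb_nonneg hα x)
    (karamata (bb_nonneg hα x) (fun _ hs => (bb_hasSum hα x x hs).summable) (bb_diag_lim hα hx))

theorem bb_off {α : ℝ} (hα : -1 < α) {x y : ℝ} (hx : 0 < x) (hy : 0 < y) (hxy : x ≠ y) :
    Tendsto (fun N : ℕ => √(N : ℝ) * ∑' i, bb α x y (i + N + 1) / ((i + N + 1 : ℕ) : ℝ)) atTop
      (𝓝 0) := by
  obtain ⟨sx, tx⟩ := bb_diag hα hx
  obtain ⟨sy, ty⟩ := bb_diag hα hy
  set c : ℕ → ℝ := fun n => bb α x x n + bb α y y n + 2 * bb α x y n with hc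
  have hc0 : ∀ n, 0 ≤ c n := by
    intro n
    have := gam_pos hα n
    have e : c n = n.factorial / Real.Gamma ((n:ℝ)+α+1) *
        (assocLaguerre α n x + assocLaguerre α n y) ^ 2 := by
      simp only [hc, bb]; ring
    rw [e]
    positivity
  have hcs : ∀ s : ℝ, 0 < s → HasSum (fun n => c n * Real.exp (-s) ^ n)
      (hhVal α x x (Real.exp (-s)) + hhVal α y y (Real.exp (-s)) + 2 * hhVal α x y (Real.exp (-s))) := by
    intro s hs
    have := ((bb_hasSum hα x x hs).add (bb_hasSum hα y y hs)).add ((bb_hasSum hα x y hs).mul_left 2)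
    refine (hasSum_cg fun n => ?_).mp this
    simp only [hc]; ring
  have hlim := ((t_to_s (hh_diag_t hα hx)).add (t_to_s (hh_diag_t hα hy))).add
    ((t_to_s (hh_off_t hα hx hy hxy)).const_mul 2)
  obtain ⟨sc, tc⟩ := tail_of_partial hc0 (karamata hc0 (fun s hs => (hcs s hs).summable)
    (hlim.congr' (by
      filter_upwards [self_mem_nhdsWithin] with s hs
      rw [(hcs s hs).tsum_eq]
      ring)))
  have h := ((tc.sub tx).sub ty).const_mul (1 / 2)
  refine Tendsto.congr (fun N => ?_) (h.trans (le_of_eq (congrArg 𝓝 ?_)))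
  · have e : ∀ i, bb α x y (i + N + 1) / ((i + N + 1 : ℕ) : ℝ) =
        1 / 2 * (c (i + N + 1) / ((i + N + 1 : ℕ) : ℝ) - bb α x x (i + N + 1) / ((i + N + 1 : ℕ) : ℝ)
          - bb α y y (i + N + 1) / ((i + N + 1 : ℕ) : ℝ)) := by
      intro i
      simp only [hc]; ring
    simp only [e]
    rw [tsum_mul_left, ((sc N).sub (sx N)).tsum_sub (sy N), (sc N).tsum_sub (sx N)]
    ring
  · ring

theorem bb_term (α x y : ℝ) (n : ℕ) :
    Real.Gamma ((n + 1 : ℕ) : ℝ) * assocLaguerre α (n + 1) x * assocLaguerre α (n + 1) y /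
      Real.Gamma (((n + 1 : ℕ) : ℝ) + α + 1) = bb α x y (n + 1) / ((n + 1 : ℕ) : ℝ) := by
  unfold bb
  have h : Real.Gamma ((n + 1 : ℕ) : ℝ) = n.factorial := by
    push_cast; exact Real.Gamma_nat_eq_factorial n
  have h0 : ((n + 1 : ℕ) : ℝ) ≠ 0 := by positivity
  rw [h, Nat.factorial_succ, Nat.cast_mul]
  field_simp

/-- Asymptotic error in the eigenfunction expansion of the Green's function associated
with the associated Laguerre polynomials: on-diagonal limit with scaling `√N` and
off-diagonal vanishing for every scaling exponent `γ < 1/2`. -/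
theorem truncated_green_laguerre_asymptotics (α : ℝ) (hα : α > -1) :
    (∀ x : ℝ, 0 < x →
      Tendsto
        (fun N : ℕ => Real.sqrt N *
          ∑' n : ℕ,
            Real.Gamma ((n + N + 1 : ℕ) : ℝ) * assocLaguerre α (n + N + 1) x ^ 2 /
              Real.Gamma (((n + N + 1 : ℕ) : ℝ) + α + 1))
        atTop (nhds (x ^ (-α - 1 / 2) * Real.exp x / Real.pi))) ∧
    (∀ x y : ℝ, 0 < x → 0 < y → x ≠ y → ∀ γ : ℝ, γ < 1 / 2 →
      Tendsto
        (fun N : ℕ => (N : ℝ) ^ γ *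
          ∑' n : ℕ,
            Real.Gamma ((n + N + 1 : ℕ) : ℝ) * assocLaguerre α (n + N + 1) x *
              assocLaguerre α (n + N + 1) y / Real.Gamma (((n + N + 1 : ℕ) : ℝ) + α + 1))
        atTop (nhds 0)) := by
  constructor
  · intro x hx
    have h := (bb_diag hα hx).2
    have e : 2 * (1/(2*√Real.pi) * x^(-α-1/2) * Real.exp x) / √Real.pi =
        x ^ (-α - 1 / 2) * Real.exp x / Real.pi := by
      have p : √Real.pi ≠ 0 := by positivity
      have q : √Real.pi ^ 2 = Real.pi := Real.sq_sqrt Real.pi_pos.le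
      rw [← q, Real.sqrt_sq (Real.sqrt_nonneg _)]
      field_simp
    rw [e] at h
    refine h.congr fun N => ?_
    simp only [← bb_term, pow_two, mul_assoc]
  · intro x y hx hy hxy γ hγ
    have h := bb_off hα hx hy hxy
    have h2 : Tendsto (fun N : ℕ => (N : ℝ) ^ (-(1 / 2 - γ))) atTop (𝓝 0) :=
      (tendsto_rpow_neg_atTop (by linarith)).comp tendsto_natCast_atTop_atTop
    have h3 := h2.mul h
    rw [mul_zero] at h3
    refine h3.congr' ?_
    filter_upwards [eventually_gt_atTop 0] with N hN
    have hN' : (0 : ℝ) < N := by exact_mod_cast hN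
    simp only [bb_term]
    rw [← mul_assoc, Real.sqrt_eq_rpow, ← Real.rpow_add hN']
    congr 2
    ring
end
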